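/- arXiv:1411.6149 — 2 statements merged into one kernel-verified Lean document; each statement's English description precedes it below -/
import Mathlib

section
/- Fix k ≥ 3 and let λ̄_k = inf_{q∈(0,1)} √( −(k/(2 q^k)) log(1−q²) ). For any fixed λ with 0 ≤ λ < λ̄_k, the total variation distance between P_λ (the law of X = λ v₁⊗v₂⊗···⊗v_k + Z in ⊗^k ℝ^n, where v₁,…,v_k are independent uniform vectors on the unit sphere S^{n−1} and Z is an independent asymmetric standard normal tensor) and P_0 (the law of Z) converges to 0 as n → ∞. -/
open MeasureTheory ProbabilityTheory Filter
open scoped ENNReal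

noncomputable section

/-- Product of i.i.d. standard Gaussians indexed by `ι`. -/
def stdGaussianPi (ι : Type*) [Fintype ι] : Measure (ι → ℝ) :=
  Measure.pi fun _ => gaussianReal 0 1

/-- The uniform (rotation-invariant) probability measure on the unit sphere `S^{n-1} ⊆ ℝⁿ`,
realized as the law of a normalized standard Gaussian vector. -/
def sphereUniform (n : ℕ) : Measure (EuclideanSpace ℝ (Fin n)) :=
  ((stdGaussianPi (Fin n)).map
      fun x => ((EuclideanSpace.equiv (Fin n) ℝ).symm x : EuclideanSpace ℝ (Fin n))).map
    fun v => ‖v‖⁻¹ • v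

/-- Asymmetric standard normal noise tensor: i.i.d. `N(0,1/n)` entries. -/
def asymNoise (k n : ℕ) : Measure ((Fin k → Fin n) → ℝ) :=
  (stdGaussianPi (Fin k → Fin n)).map fun g idx => g idx / Real.sqrt n

/-- Law of the spiked asymmetric tensor `X = λ v₁⊗⋯⊗v_k + Z`, with `v₁,…,v_k` i.i.d. uniform on
the unit sphere and `Z` an independent asymmetric standard normal tensor. -/
def spikedAsymTensor (k n : ℕ) (lam : ℝ) : Measure ((Fin k → Fin n) → ℝ) :=
  ((Measure.pi fun _ : Fin k => sphereUniform n).prod (asymNoise k n)).map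
    fun p idx => lam * (∏ j, p.1 j (idx j)) + p.2 idx

/-- Total variation distance `‖P − Q‖_TV = sup_A |P(A) − Q(A)|` over measurable sets `A`. -/
def tvDist {Ω : Type*} [MeasurableSpace Ω] (P Q : Measure Ω) : ℝ :=
  ⨆ s : {s : Set Ω // MeasurableSet s}, |(P s).toReal - (Q s).toReal|

/-- The asymmetric second-moment threshold `λ̄_k = inf_{q∈(0,1)} √(−(k/(2q^k)) log(1−q²))`. -/
def lambdaBar (k : ℕ) : ℝ :=
  sInf {x : ℝ | ∃ q ∈ Set.Ioo (0 : ℝ) 1,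
    x = Real.sqrt (-((k : ℝ) / (2 * q ^ k)) * Real.log (1 - q ^ 2))}

section Gaussian

/-- The partition function of a tilted standard Gaussian. -/
lemma lintegral_exp_gaussianReal (b : ℝ) {d : ℝ} (hd : 0 < 1 + d) :
    ∫⁻ x, ENNReal.ofReal (Real.exp (b * x - d * x ^ 2 / 2)) ∂(gaussianReal 0 1) =
      ENNReal.ofReal ((Real.sqrt (1 + d))⁻¹ * Real.exp (b ^ 2 / (2 * (1 + d)))) := by
  set v : NNReal := ⟨(1 + d)⁻¹, by positivity⟩ with hv
  have hv0 : v ≠ 0 := by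
    rw [← NNReal.coe_ne_zero]
    exact (inv_pos.2 hd).ne'
  have hvc : (v : ℝ) = (1 + d)⁻¹ := rfl
  rw [gaussianReal_of_var_ne_zero _ one_ne_zero,
    lintegral_withDensity_eq_lintegral_mul _ (measurable_gaussianPDF _ _) (by fun_prop)]
  have key : ∀ x, (gaussianPDF 0 1 * fun x => ENNReal.ofReal (Real.exp (b * x - d * x ^ 2 / 2))) x =
      ENNReal.ofReal ((Real.sqrt (1 + d))⁻¹ * Real.exp (b ^ 2 / (2 * (1 + d)))) *
        gaussianPDF (b / (1 + d)) v x := by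
    intro x
    simp only [Pi.mul_apply, gaussianPDF]
    rw [← ENNReal.ofReal_mul (gaussianPDFReal_nonneg _ _ _), ← ENNReal.ofReal_mul (by positivity)]
    congr 1
    simp only [gaussianPDFReal, hvc, NNReal.coe_one]
    have h1 : Real.sqrt (2 * Real.pi * (1 + d)⁻¹) =
        Real.sqrt (2 * Real.pi) * (Real.sqrt (1 + d))⁻¹ := by
      rw [Real.sqrt_mul (by positivity), Real.sqrt_inv]
    have h2 : Real.sqrt (1 + d) ≠ 0 := by positivity
    rw [h1, mul_assoc, ← Real.exp_add, mul_one, mul_inv, inv_inv]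
    have h3 : -(x - 0) ^ 2 / (2 * 1) + (b * x - d * x ^ 2 / 2) =
        b ^ 2 / (2 * (1 + d)) + -(x - b / (1 + d)) ^ 2 / (2 * (1 + d)⁻¹) := by
      field_simp
      ring
    rw [h3, Real.exp_add]
    field_simp
  rw [lintegral_congr key, lintegral_const_mul _ (measurable_gaussianPDF _ _),
    lintegral_gaussianPDF_eq_one _ hv0, mul_one]

lemma lintegral_pi_prod {ι : Type*} [Fintype ι] {Ω : ι → Type*} [∀ i, MeasurableSpace (Ω i)]
    (μ : ∀ i, Measure (Ω i)) [∀ i, IsProbabilityMeasure (μ i)] {f : ∀ i, Ω i → ℝ≥0∞}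
    (hf : ∀ i, Measurable (f i)) :
    ∫⁻ x, ∏ i, f i (x i) ∂(Measure.pi μ) = ∏ i, ∫⁻ x, f i x ∂(μ i) := by
  rw [lintegral_prod_eq_prod_lintegral_of_indepFun Finset.univ
    (fun i (x : ∀ i, Ω i) => f i (x i))
    (iIndepFun_pi fun i => (hf i).aemeasurable) fun i => (hf i).comp (measurable_pi_apply i)]
  refine Finset.prod_congr rfl fun i _ => ?_
  exact (measurePreserving_eval μ i).lintegral_comp (hf i)

instance {ι : Type*} [Fintype ι] : IsProbabilityMeasure (stdGaussianPi ι) := by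
  unfold stdGaussianPi; infer_instance

lemma lintegral_exp_stdGaussianPi {ι : Type*} [Fintype ι] (b : ι → ℝ) {d : ℝ} (hd : 0 < 1 + d) :
    ∫⁻ x, ENNReal.ofReal (Real.exp (∑ i, b i * x i - d * (∑ i, x i ^ 2) / 2))
        ∂(stdGaussianPi ι) =
      ENNReal.ofReal ((Real.sqrt (1 + d))⁻¹ ^ Fintype.card ι *
        Real.exp ((∑ i, b i ^ 2) / (2 * (1 + d)))) := by
  have h : ∀ x : ι → ℝ, ENNReal.ofReal (Real.exp (∑ i, b i * x i - d * (∑ i, x i ^ 2) / 2)) =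
      ∏ i, ENNReal.ofReal (Real.exp (b i * x i - d * x i ^ 2 / 2)) := by
    intro x
    rw [← ENNReal.ofReal_prod_of_nonneg (fun i _ => (Real.exp_pos _).le), ← Real.exp_sum,
      Finset.sum_sub_distrib, Finset.mul_sum, Finset.sum_div]
  rw [lintegral_congr h, stdGaussianPi,
    lintegral_pi_prod _ (f := fun i x => ENNReal.ofReal (Real.exp (b i * x - d * x ^ 2 / 2)))
      (fun i => by fun_prop)]
  simp_rw [lintegral_exp_gaussianReal _ hd]
  rw [← ENNReal.ofReal_prod_of_nonneg (fun i _ => by positivity), Finset.prod_mul_distrib,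
    Finset.prod_const, ← Real.exp_sum, Finset.sum_div, Finset.card_univ]

/-- Translating a standard Gaussian vector amounts to an exponential change of density. -/
lemma map_add_stdGaussianPi {ι : Type*} [Fintype ι] (c : ι → ℝ) :
    (stdGaussianPi ι).map (fun x => x + c) = (stdGaussianPi ι).withDensity
      fun x => ENNReal.ofReal (Real.exp (∑ i, c i * x i - (∑ i, c i ^ 2) / 2)) := by
  have h1 : (stdGaussianPi ι).map (fun x => x + c) = Measure.pi fun i => gaussianReal (c i) 1 := by
    have := Measure.pi_map_pi (μ := fun _ : ι => gaussianReal 0 1)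
      (f := fun i x => x + c i) (fun i => by fun_prop)
    rw [stdGaussianPi]
    refine Eq.trans ?_ (this.trans ?_)
    · rfl
    · congr 1
      ext1 i
      rw [gaussianReal_map_add_const, zero_add]
  rw [h1]
  refine Measure.pi_eq fun s hs => ?_
  rw [withDensity_apply _ (MeasurableSet.univ_pi hs),
    ← lintegral_indicator (MeasurableSet.univ_pi hs)]
  have h2 : ∀ x : ι → ℝ, (Set.univ.pi s).indicator
      (fun x => ENNReal.ofReal (Real.exp (∑ i, c i * x i - (∑ i, c i ^ 2) / 2))) x =
      ∏ i, (s i).indicator (fun y => ENNReal.ofReal (Real.exp (c i * y - c i ^ 2 / 2))) (x i) := by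
    intro x
    by_cases hx : ∀ i, x i ∈ s i
    · rw [Set.indicator_of_mem (by simpa [Set.mem_pi] using hx),
        Finset.prod_congr rfl fun i _ => Set.indicator_of_mem (hx i) _,
        ← ENNReal.ofReal_prod_of_nonneg (fun i _ => (Real.exp_pos _).le), ← Real.exp_sum,
        Finset.sum_sub_distrib, Finset.sum_div]
    · rw [Set.indicator_of_notMem (by simpa [Set.mem_pi] using hx)]
      push Not at hx
      obtain ⟨i, hi⟩ := hx
      exact (Finset.prod_eq_zero (Finset.mem_univ i) (Set.indicator_of_notMem hi _)).symm
  rw [lintegral_congr h2, stdGaussianPi, lintegral_pi_prod _ (f := fun i =>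
    (s i).indicator (fun y => ENNReal.ofReal (Real.exp (c i * y - c i ^ 2 / 2))))
    (fun i => Measurable.indicator (by fun_prop) (hs i))]
  refine Finset.prod_congr rfl fun i _ => ?_
  rw [lintegral_indicator (hs i), gaussianReal_of_var_ne_zero _ one_ne_zero,
    gaussianReal_of_var_ne_zero _ one_ne_zero, setLIntegral_withDensity_eq_setLIntegral_mul _
      (measurable_gaussianPDF _ _) (by fun_prop) (hs i), withDensity_apply _ (hs i)]
  refine lintegral_congr fun x => ?_
  simp only [Pi.mul_apply, gaussianPDF]
  rw [← ENNReal.ofReal_mul (gaussianPDFReal_nonneg _ _ _)]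
  congr 1
  simp only [gaussianPDFReal]
  rw [mul_assoc, ← Real.exp_add]
  congr 2
  simp only [NNReal.coe_one]
  ring

/-- Exponential moment of the quadratic form `⟨w, x⟩² - (y - 1) (‖x‖² - ⟨w, x⟩²)`, in the
direction of a unit vector `w`. -/
lemma lintegral_exp_quadratic_stdGaussianPi {ι : Type*} [Fintype ι] (w : ι → ℝ)
    (hw : ∑ i, w i ^ 2 = 1) {s y : ℝ} (hs0 : 0 ≤ s) (hs1 : s < 1) (hy : 1 ≤ y) :
    ∫⁻ x, ENNReal.ofReal (Real.exp
        (s / 2 * (y * (∑ i, w i * x i) ^ 2 - (y - 1) * ∑ i, x i ^ 2))) ∂(stdGaussianPi ι) =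
      ENNReal.ofReal ((Real.sqrt (1 - s))⁻¹ *
        ((Real.sqrt (1 + s * (y - 1)))⁻¹ ^ Fintype.card ι * Real.sqrt (1 + s * (y - 1)))) := by
  set d := s * (y - 1) with hd
  have hd0 : 0 ≤ d := mul_nonneg hs0 (by linarith)
  have hsy : 0 ≤ s * y := mul_nonneg hs0 (by linarith)
  have h1 : ∀ x : ι → ℝ, ENNReal.ofReal (Real.exp
        (s / 2 * (y * (∑ i, w i * x i) ^ 2 - (y - 1) * ∑ i, x i ^ 2))) =
      ∫⁻ z, ENNReal.ofReal (Real.exp (∑ i, (Real.sqrt (s * y) * z * w i) * x i -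
        d * (∑ i, x i ^ 2) / 2)) ∂(gaussianReal 0 1) := by
    intro x
    have h2 : ∀ z : ℝ, ENNReal.ofReal (Real.exp (∑ i, (Real.sqrt (s * y) * z * w i) * x i -
        d * (∑ i, x i ^ 2) / 2)) =
        ENNReal.ofReal (Real.exp (- (d * (∑ i, x i ^ 2) / 2))) * ENNReal.ofReal
          (Real.exp ((Real.sqrt (s * y) * ∑ i, w i * x i) * z - 0 * z ^ 2 / 2)) := by
      intro z
      rw [← ENNReal.ofReal_mul (Real.exp_pos _).le, ← Real.exp_add]
      congr 2
      simp only [mul_assoc, Finset.mul_sum, Finset.sum_mul]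
      have : ∀ i, Real.sqrt (s * y) * (z * (w i * x i)) =
        Real.sqrt (s * y) * (w i * (x i * z)) := fun i => by ring
      simp only [this]
      ring
    rw [lintegral_congr h2, lintegral_const_mul _ (by fun_prop),
      lintegral_exp_gaussianReal _ (by norm_num), ← ENNReal.ofReal_mul (Real.exp_pos _).le]
    congr 1
    simp only [add_zero, Real.sqrt_one, inv_one, one_mul, mul_one]
    rw [← Real.exp_add, mul_pow, Real.sq_sqrt hsy]
    congr 1
    rw [hd]; ring
  rw [lintegral_congr h1, lintegral_lintegral_swap (by fun_prop)]
  have hd1 : 0 < 1 + d := by linarith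
  have h3 : ∀ z : ℝ, ∫⁻ x, ENNReal.ofReal (Real.exp (∑ i, (Real.sqrt (s * y) * z * w i) * x i -
        d * (∑ i, x i ^ 2) / 2)) ∂(stdGaussianPi ι) =
      ENNReal.ofReal ((Real.sqrt (1 + d))⁻¹ ^ Fintype.card ι) * ENNReal.ofReal
        (Real.exp (0 * z - (- (s * y / (1 + d))) * z ^ 2 / 2)) := by
    intro z
    rw [lintegral_exp_stdGaussianPi _ hd1, ENNReal.ofReal_mul (by positivity)]
    congr 3
    simp only [mul_pow]
    rw [← Finset.mul_sum, hw, Real.sq_sqrt hsy]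
    field_simp
    ring
  have h4 : 1 + -(s * y / (1 + d)) = (1 - s) / (1 + d) := by
    field_simp; rw [hd]; ring
  rw [lintegral_congr h3, lintegral_const_mul _ (by fun_prop), lintegral_exp_gaussianReal _
    (by rw [h4]; exact div_pos (by linarith) hd1), ← ENNReal.ofReal_mul (by positivity), h4]
  congr 1
  rw [Real.sqrt_div (by linarith)]
  simp
  ring

end Gaussian
section SecondMoment

/-- The second moment method: a density with second moment at most `1 + e` is within
total variation `√e` of the reference measure. -/
lemma abs_withDensity_sub_le {Ω : Type*} [MeasurableSpace Ω] (μ : Measure Ω)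
    [IsProbabilityMeasure μ] {L : Ω → ℝ≥0∞} (hL : Measurable L) (h1 : ∫⁻ x, L x ∂μ = 1)
    {e : ℝ} (h2 : ∫⁻ x, L x ^ 2 ∂μ ≤ ENNReal.ofReal (1 + e)) {A : Set Ω}
    (hA : MeasurableSet A) :
    |(μ.withDensity L A).toReal - (μ A).toReal| ≤ Real.sqrt e := by
  have hlm : Measurable fun x => (L x).toReal := hL.ennreal_toReal
  have hli : Integrable (fun x => (L x).toReal) μ :=
    integrable_toReal_of_lintegral_ne_top hL.aemeasurable (by simp [h1])
  have hl1 : ∫ x, (L x).toReal ∂μ = 1 := by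
    rw [integral_toReal hL.aemeasurable (ae_lt_top hL (by simp [h1])), h1, ENNReal.toReal_one]
  have hL2 : ∫⁻ x, L x ^ 2 ∂μ ≠ ∞ := ne_top_of_le_ne_top ENNReal.ofReal_ne_top h2
  have hsq : Integrable (fun x => (L x).toReal ^ 2) μ := by
    have := integrable_toReal_of_lintegral_ne_top (f := fun x => L x ^ 2) (μ := μ)
      (by fun_prop) hL2
    simpa only [ENNReal.toReal_pow] using this
  have hsqi : 0 ≤ 1 + e → ∫ x, (L x).toReal ^ 2 ∂μ ≤ 1 + e := by
    intro he
    have h3 := integral_toReal (f := fun x => L x ^ 2) (μ := μ) (by fun_prop)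
      (ae_lt_top (by fun_prop) hL2)
    simp only [ENNReal.toReal_pow] at h3
    rw [h3]
    exact ENNReal.toReal_le_of_le_ofReal he h2
  have hmem : MemLp (fun x => (L x).toReal) 2 μ :=
    (memLp_two_iff_integrable_sq hlm.aestronglyMeasurable).2 hsq
  have hmem1 : MemLp (fun x => (L x).toReal - 1) 2 μ := hmem.sub (memLp_const 1)
  have hmemA : MemLp (A.indicator fun x => (L x).toReal - 1) 2 μ := hmem1.indicator hA
  have hint : (μ.withDensity L A).toReal - (μ A).toReal =
      ∫ x, A.indicator (fun x => (L x).toReal - 1) x ∂μ := by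
    rw [integral_indicator hA, integral_sub hli.integrableOn (integrable_const 1),
      withDensity_apply _ hA, integral_toReal hL.aemeasurable
        (ae_restrict_of_ae (ae_lt_top hL (by simp [h1])))]
    simp [Measure.real]
  have he : 0 ≤ 1 + e := by
    by_contra hneg
    rw [ENNReal.ofReal_of_nonpos (by linarith), nonpos_iff_eq_zero,
      lintegral_eq_zero_iff (by fun_prop)] at h2
    have h4 : ∫⁻ x, L x ∂μ = 0 := by
      rw [lintegral_eq_zero_iff hL]
      filter_upwards [h2] with x hx
      simpa using hx
    simp [h1] at h4
  rw [hint]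
  refine Real.abs_le_sqrt ?_
  have hvar := variance_nonneg (A.indicator fun x => (L x).toReal - 1) μ
  rw [variance_eq_sub hmemA] at hvar
  have h5 : ∫ x, (A.indicator (fun x => (L x).toReal - 1) ^ 2) x ∂μ ≤
      ∫ x, ((L x).toReal - 1) ^ 2 ∂μ := by
    refine integral_mono hmemA.integrable_sq hmem1.integrable_sq fun x => ?_
    by_cases hx : x ∈ A
    · simp [hx]
    · simpa [hx] using sq_nonneg _
  have h6 : ∫ x, ((L x).toReal - 1) ^ 2 ∂μ = ∫ x, (L x).toReal ^ 2 ∂μ - 1 := by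
    have : ∀ x, ((L x).toReal - 1) ^ 2 = (L x).toReal ^ 2 - 2 * (L x).toReal + 1 :=
      fun x => by ring
    simp only [this]
    have hsub : Integrable (fun x => (L x).toReal ^ 2 - 2 * (L x).toReal) μ :=
      hsq.sub (hli.const_mul 2)
    rw [integral_add hsub (integrable_const 1), integral_sub hsq (hli.const_mul 2),
      integral_const_mul, hl1]
    simp
    ring
  have := hsqi he
  linarith

lemma lintegral_lintegral_sq {V Ω : Type*} [MeasurableSpace V] [MeasurableSpace Ω]
    (π : Measure V) [SFinite π] (μ : Measure Ω) [SFinite μ] {l : V → Ω → ℝ≥0∞}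
    (hl : Measurable (Function.uncurry l)) :
    ∫⁻ x, (∫⁻ v, l v x ∂π) ^ 2 ∂μ = ∫⁻ v, ∫⁻ v', ∫⁻ x, l v x * l v' x ∂μ ∂π ∂π := by
  have hlv : ∀ v, Measurable (l v) := fun v => hl.comp measurable_prodMk_left
  have hlx : ∀ x, Measurable fun v => l v x := fun v => hl.comp measurable_prodMk_right
  have hl' : Measurable fun p : Ω × V => l p.2 p.1 := hl.comp measurable_swap
  have h4 : ∀ x, (∫⁻ v, l v x ∂π) ^ 2 = ∫⁻ v, ∫⁻ v', l v x * l v' x ∂π ∂π := by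
    intro x
    rw [sq, ← lintegral_mul_const _ (hlx x)]
    exact lintegral_congr fun v => (lintegral_const_mul _ (hlx x)).symm
  have hm3 : Measurable fun p : (Ω × V) × V => l p.1.2 p.1.1 * l p.2 p.1.1 :=
    (hl'.comp measurable_fst).mul
      (hl.comp (measurable_snd.prodMk (measurable_fst.comp measurable_fst)))
  have hm2 : Measurable fun p : Ω × V => ∫⁻ v', l p.2 p.1 * l v' p.1 ∂π :=
    hm3.lintegral_prod_right'
  rw [lintegral_congr h4, lintegral_lintegral_swap hm2.aemeasurable]
  refine lintegral_congr fun v => ?_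
  refine lintegral_lintegral_swap (f := fun x v' => l v x * l v' x) ?_
  exact (((hlv v).comp measurable_fst).mul hl').aemeasurable

/-- The density of the standard Gaussian translated by `c` with respect to the standard one. -/
def gaussianShift {ι : Type*} [Fintype ι] (c x : ι → ℝ) : ℝ≥0∞ :=
  ENNReal.ofReal (Real.exp (∑ i, c i * x i - (∑ i, c i ^ 2) / 2))

lemma lintegral_gaussianShift_mul {ι : Type*} [Fintype ι] (c c' : ι → ℝ) :
    ∫⁻ x, gaussianShift c x * gaussianShift c' x ∂(stdGaussianPi ι) =
      ENNReal.ofReal (Real.exp (∑ i, c i * c' i)) := by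
  have h3 : ∀ x, gaussianShift c x * gaussianShift c' x =
      ENNReal.ofReal (Real.exp (-(∑ i, c i ^ 2) / 2 - (∑ i, c' i ^ 2) / 2)) *
      ENNReal.ofReal (Real.exp (∑ i, (c i + c' i) * x i - 0 * (∑ i, x i ^ 2) / 2)) := by
    intro x
    simp only [gaussianShift]
    rw [← ENNReal.ofReal_mul (Real.exp_pos _).le, ← ENNReal.ofReal_mul (Real.exp_pos _).le,
      ← Real.exp_add, ← Real.exp_add]
    simp only [add_mul, Finset.sum_add_distrib]
    congr 2
    ring
  rw [lintegral_congr h3, lintegral_const_mul _ (by fun_prop),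
    lintegral_exp_stdGaussianPi _ (by norm_num), ← ENNReal.ofReal_mul (Real.exp_pos _).le]
  simp only [add_zero, Real.sqrt_one, inv_one, one_pow, one_mul, mul_one]
  rw [← Real.exp_add]
  have : ∑ i, (c i + c' i) ^ 2 = ∑ i, c i ^ 2 + 2 * ∑ i, c i * c' i + ∑ i, c' i ^ 2 := by
    rw [Finset.mul_sum, ← Finset.sum_add_distrib, ← Finset.sum_add_distrib]
    exact Finset.sum_congr rfl fun i _ => by ring
  rw [this]
  congr 2
  ring

/-- Second moment bound for a Gaussian mixture `c v + g` with `v ~ π` against its noise `g`. -/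
lemma abs_lintegral_map_add_sub_le {V ι : Type*} [MeasurableSpace V] [Fintype ι] (π : Measure V)
    [IsProbabilityMeasure π] {c : V → ι → ℝ} (hc : Measurable c) {e : ℝ}
    (h : ∫⁻ v, ∫⁻ v', ENNReal.ofReal (Real.exp (∑ i, c v i * c v' i)) ∂π ∂π ≤
      ENNReal.ofReal (1 + e)) {B : Set (ι → ℝ)} (hB : MeasurableSet B) :
    |(∫⁻ v, (stdGaussianPi ι).map (fun x => x + c v) B ∂π).toReal -
      (stdGaussianPi ι B).toReal| ≤ Real.sqrt e := by
  have hlm : Measurable (Function.uncurry fun v => gaussianShift (c v)) := by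
    simp only [gaussianShift, Function.uncurry_def]
    have : ∀ i, Measurable fun p : V × (ι → ℝ) => c p.1 i := fun i =>
      ((measurable_pi_apply i).comp hc).comp measurable_fst
    fun_prop
  have hlm' : Measurable fun p : (ι → ℝ) × V => gaussianShift (c p.2) p.1 :=
    hlm.comp measurable_swap
  have hL : Measurable fun x => ∫⁻ v, gaussianShift (c v) x ∂π := hlm'.lintegral_prod_right'
  have hmix : ∀ B, MeasurableSet B → ∫⁻ v, (stdGaussianPi ι).map (fun x => x + c v) B ∂π =
      (stdGaussianPi ι).withDensity (fun x => ∫⁻ v, gaussianShift (c v) x ∂π) B := by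
    intro B hB
    rw [withDensity_apply _ hB, lintegral_lintegral_swap hlm'.aemeasurable]
    refine lintegral_congr fun v => ?_
    rw [map_add_stdGaussianPi, withDensity_apply _ hB]
    rfl
  have h1 : ∫⁻ x, ∫⁻ v, gaussianShift (c v) x ∂π ∂(stdGaussianPi ι) = 1 := by
    have h2 := hmix Set.univ MeasurableSet.univ
    rw [withDensity_apply _ MeasurableSet.univ, Measure.restrict_univ] at h2
    rw [← h2]
    have : ∀ v, (stdGaussianPi ι).map (fun x => x + c v) Set.univ = 1 := by
      intro v
      rw [Measure.map_apply (by fun_prop) MeasurableSet.univ]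
      simp
    simp [this]
  rw [hmix B hB]
  refine abs_withDensity_sub_le _ hL h1 (le_of_eq_of_le ?_ h) hB
  rw [lintegral_lintegral_sq π (stdGaussianPi ι) hlm]
  exact lintegral_congr fun v => lintegral_congr fun v' => lintegral_gaussianShift_mul _ _

end SecondMoment

section Overlap

/-- The angle between a unit vector and a standard Gaussian vector is rarely small. -/
lemma stdGaussianPi_overlap_tail {ι : Type*} [Fintype ι] [Nonempty ι] (w : ι → ℝ)
    (hw : ∑ i, w i ^ 2 = 1) {s y : ℝ} (hs0 : 0 ≤ s) (hs1 : s < 1) (hy : 1 ≤ y) :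
    stdGaussianPi ι {x | y * (∑ i, x i ^ 2 - (∑ i, w i * x i) ^ 2) ≤ ∑ i, x i ^ 2} ≤
      ENNReal.ofReal ((Real.sqrt (1 - s))⁻¹ * y ^ (-(s * ((Fintype.card ι : ℝ) - 1) / 2))) := by
  have hd0 : 0 ≤ s * (y - 1) := mul_nonneg hs0 (by linarith)
  have hcard : (1 : ℝ) ≤ Fintype.card ι := by exact_mod_cast Fintype.card_pos
  refine (meas_le_lintegral₀ (f := fun x => ENNReal.ofReal (Real.exp
        (s / 2 * (y * (∑ i, w i * x i) ^ 2 - (y - 1) * ∑ i, x i ^ 2))))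
        (by fun_prop) fun x hx => ?_).trans ?_
  · rw [Set.mem_ofPred_eq] at hx
    rw [← ENNReal.ofReal_one]
    refine ENNReal.ofReal_le_ofReal (Real.one_le_exp (mul_nonneg (by linarith) ?_))
    nlinarith
  · rw [lintegral_exp_quadratic_stdGaussianPi w hw hs0 hs1 hy]
    refine ENNReal.ofReal_le_ofReal (mul_le_mul_of_nonneg_left ?_ (by positivity))
    have h1 : 0 < 1 + s * (y - 1) := by linarith
    have h2 : (Real.sqrt (1 + s * (y - 1)))⁻¹ ^ Fintype.card ι * Real.sqrt (1 + s * (y - 1)) =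
        (1 + s * (y - 1)) ^ (-(((Fintype.card ι : ℝ) - 1) / 2)) := by
      rw [Real.sqrt_eq_rpow, ← Real.rpow_neg h1.le, ← Real.rpow_natCast, ← Real.rpow_mul h1.le,
        ← Real.rpow_add h1]
      congr 1
      ring
    have h3 : y ^ s ≤ 1 + s * (y - 1) := by
      have := rpow_one_add_le_one_add_mul_self (s := y - 1) (by linarith) hs0 hs1.le
      simpa using this
    rw [h2]
    calc (1 + s * (y - 1)) ^ (-(((Fintype.card ι : ℝ) - 1) / 2))
        ≤ (y ^ s) ^ (-(((Fintype.card ι : ℝ) - 1) / 2)) :=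
          Real.rpow_le_rpow_of_nonpos (by positivity) h3 (by linarith)
      _ = _ := by
          rw [← Real.rpow_mul (by linarith)]
          congr 1
          ring

lemma lintegral_rpow_le_of_tail {Ω : Type*} [MeasurableSpace Ω] {μ : Measure Ω}
    [IsProbabilityMeasure μ] {X : Ω → ℝ} (hX : Measurable X) (hX0 : ∀ x, 0 ≤ X x) {a b C : ℝ}
    (ha : 0 < a) (hab : a < b) (hC : 0 ≤ C)
    (htail : ∀ y : ℝ, 1 ≤ y → μ {x | y ≤ X x} ≤ ENNReal.ofReal (C * y ^ (-b))) :
    ∫⁻ x, ENNReal.ofReal (X x ^ a) ∂μ ≤ ENNReal.ofReal (1 + a * C / (b - a)) := by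
  have hba : 0 < b - a := by linarith
  rw [lintegral_rpow_eq_lintegral_meas_le_mul μ (Eventually.of_forall hX0) hX.aemeasurable ha,
    ← Set.Ioc_union_Ioi_eq_Ioi zero_le_one, lintegral_union measurableSet_Ioi
      (Set.Ioc_disjoint_Ioi le_rfl)]
  have h1 : ∫⁻ t in Set.Ioc (0 : ℝ) 1, μ {x | t ≤ X x} * ENNReal.ofReal (t ^ (a - 1)) ≤
      ENNReal.ofReal (1 / a) := by
    have hi : IntegrableOn (fun t : ℝ => t ^ (a - 1)) (Set.Ioc 0 1) := by
      rw [← intervalIntegrable_iff_integrableOn_Ioc_of_le zero_le_one]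
      exact intervalIntegral.intervalIntegrable_rpow' (by linarith)
    have hv : ∫ t in Set.Ioc (0 : ℝ) 1, t ^ (a - 1) = 1 / a := by
      rw [← intervalIntegral.integral_of_le zero_le_one, integral_rpow (Or.inl (by linarith))]
      simp [ha.ne']
    rw [← hv, ofReal_integral_eq_lintegral_ofReal hi
      ((ae_restrict_iff' measurableSet_Ioc).2 (Eventually.of_forall fun t ht =>
        Real.rpow_nonneg ht.1.le _))]
    exact lintegral_mono fun t => mul_le_of_le_one_left zero_le prob_le_one
  have h2 : ∫⁻ t in Set.Ioi (1 : ℝ), μ {x | t ≤ X x} * ENNReal.ofReal (t ^ (a - 1)) ≤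
      ENNReal.ofReal (C * (1 / (b - a))) := by
    have hi : IntegrableOn (fun t : ℝ => t ^ (a - b - 1)) (Set.Ioi 1) :=
      integrableOn_Ioi_rpow_of_lt (by linarith) zero_lt_one
    have hv : ∫ t in Set.Ioi (1 : ℝ), C * t ^ (a - b - 1) = C * (1 / (b - a)) := by
      rw [integral_const_mul, integral_Ioi_rpow_of_lt (by linarith) zero_lt_one]
      simp only [sub_add_cancel, Real.one_rpow]
      rw [neg_div, ← div_neg, neg_sub]
    rw [← hv, ofReal_integral_eq_lintegral_ofReal (hi.const_mul C)
      ((ae_restrict_iff' measurableSet_Ioi).2 (Eventually.of_forall fun t ht =>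
        mul_nonneg hC (Real.rpow_nonneg (zero_le_one.trans (le_of_lt ht)) _)))]
    refine setLIntegral_mono' measurableSet_Ioi fun t ht => ?_
    have ht0 : (0 : ℝ) < t := zero_lt_one.trans ht
    calc μ {x | t ≤ X x} * ENNReal.ofReal (t ^ (a - 1))
        ≤ ENNReal.ofReal (C * t ^ (-b)) * ENNReal.ofReal (t ^ (a - 1)) := by
          gcongr
          exact htail t (le_of_lt ht)
      _ = _ := by
          rw [← ENNReal.ofReal_mul (by positivity), mul_assoc, ← Real.rpow_add ht0]
          congr 3
          ring
  calc _ ≤ ENNReal.ofReal a * (ENNReal.ofReal (1 / a) + ENNReal.ofReal (C * (1 / (b - a)))) := by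
        gcongr
    _ = _ := by
        rw [← ENNReal.ofReal_add (by positivity) (by positivity), ← ENNReal.ofReal_mul ha.le]
        congr 1
        field_simp

/-- The direction of `x`, as a vector of Euclidean space (zero if `x = 0`). -/
def direction {n : ℕ} (x : Fin n → ℝ) : EuclideanSpace ℝ (Fin n) :=
  ‖(EuclideanSpace.equiv (Fin n) ℝ).symm x‖⁻¹ • (EuclideanSpace.equiv (Fin n) ℝ).symm x

lemma measurable_direction {n : ℕ} : Measurable (direction (n := n)) := by
  have h : Measurable fun x : Fin n → ℝ => (EuclideanSpace.equiv (Fin n) ℝ).symm x :=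
    (EuclideanSpace.equiv (Fin n) ℝ).symm.continuous.measurable
  exact h.norm.inv.smul h

lemma sphereUniform_eq_map_direction (n : ℕ) :
    sphereUniform n = (stdGaussianPi (Fin n)).map direction := by
  have h : Measurable fun x : Fin n → ℝ => (EuclideanSpace.equiv (Fin n) ℝ).symm x :=
    (EuclideanSpace.equiv (Fin n) ℝ).symm.continuous.measurable
  rw [sphereUniform, Measure.map_map (by fun_prop) h]
  rfl

instance (n : ℕ) : IsProbabilityMeasure (sphereUniform n) := by
  rw [sphereUniform_eq_map_direction]
  exact Measure.isProbabilityMeasure_map measurable_direction.aemeasurable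

lemma sum_direction_sq_eq_one_or_forall_eq_zero {n : ℕ} (x : Fin n → ℝ) :
    ∑ i, direction x i ^ 2 = 1 ∨ ∀ i, direction x i = 0 := by
  by_cases h : (EuclideanSpace.equiv (Fin n) ℝ).symm x = 0
  · right
    simp [direction, h]
  · left
    rw [← EuclideanSpace.real_norm_sq_eq, direction, norm_smul, norm_inv, norm_norm,
      inv_mul_cancel₀ (norm_ne_zero_iff.2 h), one_pow]

lemma sum_mul_direction_sq_mul {n : ℕ} (w x : Fin n → ℝ) :
    (∑ i, w i * direction x i) ^ 2 * ∑ i, x i ^ 2 = (∑ i, w i * x i) ^ 2 := by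
  have hn : ‖(EuclideanSpace.equiv (Fin n) ℝ).symm x‖ ^ 2 = ∑ i, x i ^ 2 := by
    rw [EuclideanSpace.real_norm_sq_eq]
    rfl
  have hq : ∑ i, w i * direction x i =
      ‖(EuclideanSpace.equiv (Fin n) ℝ).symm x‖⁻¹ * ∑ i, w i * x i := by
    rw [Finset.mul_sum]
    refine Finset.sum_congr rfl fun i _ => ?_
    change w i * (‖(EuclideanSpace.equiv (Fin n) ℝ).symm x‖⁻¹ * x i) = _
    ring
  have hcs := Finset.sum_mul_sq_le_sq_mul_sq Finset.univ w x
  by_cases h : ‖(EuclideanSpace.equiv (Fin n) ℝ).symm x‖ = 0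
  · rw [← hn, h] at hcs ⊢
    nlinarith [sq_nonneg (∑ i, w i * x i)]
  · rw [hq, ← hn]
    field_simp

lemma sum_mul_direction_sq_le_one {n : ℕ} (w x : Fin n → ℝ) (hw : ∑ i, w i ^ 2 = 1) :
    (∑ i, w i * direction x i) ^ 2 ≤ 1 := by
  have hcs := Finset.sum_mul_sq_le_sq_mul_sq Finset.univ w (direction x)
  rw [hw, one_mul] at hcs
  refine hcs.trans ?_
  rcases sum_direction_sq_eq_one_or_forall_eq_zero x with h | h
  · exact h.le
  · simp [h]

lemma sphereUniform_overlap_tail {n : ℕ} (hn : 0 < n) (w : Fin n → ℝ)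
    (hw : ∑ i, w i ^ 2 = 1) {s y : ℝ} (hs0 : 0 ≤ s) (hs1 : s < 1) (hy : 1 ≤ y) :
    sphereUniform n {v | y * (1 - (∑ i, w i * v i) ^ 2) ≤ 1} ≤
      ENNReal.ofReal ((Real.sqrt (1 - s))⁻¹ * y ^ (-(s * ((n : ℝ) - 1) / 2))) := by
  have : Nonempty (Fin n) := ⟨⟨0, hn⟩⟩
  have := stdGaussianPi_overlap_tail w hw hs0 hs1 hy
  rw [Fintype.card_fin] at this
  refine le_trans ?_ this
  rw [sphereUniform_eq_map_direction, Measure.map_apply measurable_direction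
    (measurableSet_le (by fun_prop) measurable_const)]
  refine measure_mono fun x hx => ?_
  rw [Set.mem_preimage, Set.mem_ofPred_eq] at hx
  rw [Set.mem_ofPred_eq, ← sum_mul_direction_sq_mul]
  have h0 : 0 ≤ ∑ i, x i ^ 2 := Finset.sum_nonneg fun i _ => sq_nonneg _
  nlinarith [mul_le_mul_of_nonneg_right hx h0]

lemma ae_sphereUniform_overlap_sq_lt_one {n : ℕ} (hn : 1 < n) (w : Fin n → ℝ)
    (hw : ∑ i, w i ^ 2 = 1 ∨ ∀ i, w i = 0) :
    ∀ᵐ v ∂(sphereUniform n), (∑ i, w i * v i) ^ 2 < 1 := by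
  rcases hw with hw | hw
  · have hn' : (1 : ℝ) < n := by exact_mod_cast hn
    have hle : ∀ y : ℝ, 1 ≤ y → sphereUniform n {v | ¬ (∑ i, w i * v i) ^ 2 < 1} ≤
        ENNReal.ofReal ((Real.sqrt (1 - 1 / 2))⁻¹ * y ^ (-(1 / 2 * ((n : ℝ) - 1) / 2))) := by
      intro y hy
      refine (measure_mono fun v hv => ?_).trans
        (sphereUniform_overlap_tail (by lia) w hw (by norm_num) (by norm_num) hy)
      rw [Set.mem_ofPred_eq, not_lt] at hv
      rw [Set.mem_ofPred_eq]
      nlinarith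
    have hlim : Tendsto (fun y : ℝ => ENNReal.ofReal
        ((Real.sqrt (1 - 1 / 2))⁻¹ * y ^ (-(1 / 2 * ((n : ℝ) - 1) / 2)))) atTop (nhds 0) := by
      have := (tendsto_rpow_neg_atTop (y := 1 / 2 * ((n : ℝ) - 1) / 2) (by linarith)).const_mul
        (Real.sqrt (1 - 1 / 2))⁻¹
      rw [mul_zero] at this
      simpa using ENNReal.tendsto_ofReal this
    rw [ae_iff, ← nonpos_iff_eq_zero]
    exact ge_of_tendsto hlim ((eventually_ge_atTop 1).mono hle)
  · simp [hw]

lemma lintegral_sphereUniform_overlap_le {n : ℕ} (hn : 0 < n) (w : Fin n → ℝ)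
    (hw : ∑ i, w i ^ 2 = 1 ∨ ∀ i, w i = 0) {s a : ℝ} (hs0 : 0 ≤ s) (hs1 : s < 1) (ha : 0 < a)
    (hab : a < s * ((n : ℝ) - 1) / 2) :
    ∫⁻ v, ENNReal.ofReal ((1 - (∑ i, w i * v i) ^ 2)⁻¹ ^ a) ∂(sphereUniform n) ≤
      ENNReal.ofReal (1 + a * (Real.sqrt (1 - s))⁻¹ / (s * ((n : ℝ) - 1) / 2 - a)) := by
  rcases hw with hw | hw
  · have hmax : ∀ᵐ v ∂(sphereUniform n), ENNReal.ofReal ((1 - (∑ i, w i * v i) ^ 2)⁻¹ ^ a) =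
        ENNReal.ofReal ((max 0 (1 - (∑ i, w i * v i) ^ 2)⁻¹) ^ a) := by
      rw [sphereUniform_eq_map_direction]
      refine (ae_map_iff measurable_direction.aemeasurable
        (measurableSet_eq_fun (by fun_prop) (by fun_prop))).2 (Eventually.of_forall fun x => ?_)
      rw [max_eq_right]
      exact inv_nonneg.2 (sub_nonneg.2 (sum_mul_direction_sq_le_one w x hw))
    rw [lintegral_congr_ae hmax]
    refine lintegral_rpow_le_of_tail (by fun_prop) (fun v => le_max_left _ _) ha hab
      (by positivity) fun y hy => (measure_mono fun v hv => ?_).trans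
        (sphereUniform_overlap_tail hn w hw hs0 hs1 hy)
    rw [Set.mem_ofPred_eq] at hv ⊢
    rcases le_max_iff.1 hv with h | h
    · linarith
    · have hpos : 0 < 1 - (∑ i, w i * v i) ^ 2 := inv_pos.1 (by linarith)
      calc y * (1 - (∑ i, w i * v i) ^ 2)
          ≤ (1 - (∑ i, w i * v i) ^ 2)⁻¹ * (1 - (∑ i, w i * v i) ^ 2) := by gcongr
        _ = 1 := inv_mul_cancel₀ hpos.ne'
  · simp only [hw, zero_mul, Finset.sum_const_zero]
    norm_num
    exact div_nonneg (by positivity) (by linarith)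

end Overlap

section Threshold

lemma lambdaBar_sq_mul_pow_le {k : ℕ} (h0 : 0 < lambdaBar k) {t : ℝ} (ht : t ∈ Set.Ioo (0 : ℝ) 1) :
    lambdaBar k ^ 2 * t ^ k ≤ -((k : ℝ) / 2) * Real.log (1 - t ^ 2) := by
  have h1 : lambdaBar k ≤ Real.sqrt (-((k : ℝ) / (2 * t ^ k)) * Real.log (1 - t ^ 2)) := by
    refine csInf_le ⟨0, ?_⟩ ⟨t, ht, rfl⟩
    rintro x ⟨q, -, rfl⟩
    exact Real.sqrt_nonneg _
  rw [Real.le_sqrt' h0] at h1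
  have htk : 0 < t ^ k := pow_pos ht.1 k
  calc lambdaBar k ^ 2 * t ^ k
      ≤ -((k : ℝ) / (2 * t ^ k)) * Real.log (1 - t ^ 2) * t ^ k := by gcongr
    _ = _ := by field_simp

/-- A threshold inequality on the diagonal extends to unequal overlaps, by the arithmetic-geometric
mean inequality. -/
lemma mul_prod_abs_le_sum_log {k : ℕ} (hk : 0 < k) {M : ℝ}
    (hM : ∀ t ∈ Set.Ioo (0 : ℝ) 1, M * t ^ k ≤ -((k : ℝ) / 2) * Real.log (1 - t ^ 2))
    (q : Fin k → ℝ) (hq : ∀ j, q j ^ 2 < 1) :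
    M * ∏ j, |q j| ≤ 1 / 2 * ∑ j, -Real.log (1 - q j ^ 2) := by
  have hk' : (0 : ℝ) < k := by exact_mod_cast hk
  by_cases hz : ∃ j, q j = 0
  · obtain ⟨j, hj⟩ := hz
    rw [Finset.prod_eq_zero (Finset.mem_univ j) (by simp [hj]), mul_zero]
    refine mul_nonneg (by norm_num) (Finset.sum_nonneg fun i _ => ?_)
    exact neg_nonneg.2 (Real.log_nonpos (by linarith [hq i]) (by linarith [sq_nonneg (q i)]))
  push Not at hz
  have hP : 0 < ∏ j, |q j| := Finset.prod_pos fun j _ => abs_pos.2 (hz j)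
  set t : ℝ := (∏ j, |q j|) ^ (1 / (k : ℝ)) with ht
  have ht0 : 0 < t := Real.rpow_pos_of_pos hP _
  have htk : t ^ k = ∏ j, |q j| := by
    rw [ht, ← Real.rpow_natCast, ← Real.rpow_mul hP.le, one_div_mul_cancel hk'.ne', Real.rpow_one]
  have ht2 : t ^ 2 = ∏ j, (q j ^ 2) ^ (1 / (k : ℝ)) := by
    rw [Real.finsetProd_rpow _ _ fun j _ => sq_nonneg _, ht, ← Real.rpow_natCast,
      ← Real.rpow_mul hP.le, mul_comm, Real.rpow_mul hP.le, Real.rpow_natCast, ← Finset.prod_pow]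
    simp only [sq_abs]
  have hw : ∑ _j : Fin k, 1 / (k : ℝ) = 1 := by
    simp [hk'.ne']
  have hA := Real.geom_mean_le_arith_mean_weighted Finset.univ (fun _ : Fin k => 1 / (k : ℝ))
    (fun j => q j ^ 2) (fun _ _ => by positivity) hw (fun j _ => sq_nonneg _)
  have hB := Real.geom_mean_le_arith_mean_weighted Finset.univ (fun _ : Fin k => 1 / (k : ℝ))
    (fun j => 1 - q j ^ 2) (fun _ _ => by positivity) hw (fun j _ => by linarith [hq j])
  have hS : ∑ j, 1 / (k : ℝ) * q j ^ 2 + ∑ j, 1 / (k : ℝ) * (1 - q j ^ 2) = 1 := by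
    rw [← Finset.sum_add_distrib]
    refine Eq.trans (Finset.sum_congr rfl fun j _ => ?_) hw
    ring
  have hBpos : ∀ j, 0 < (1 - q j ^ 2) ^ (1 / (k : ℝ)) := fun j =>
    Real.rpow_pos_of_pos (by linarith [hq j]) _
  have hBp : 0 < ∏ j, (1 - q j ^ 2) ^ (1 / (k : ℝ)) := Finset.prod_pos fun j _ => hBpos j
  have hle : ∏ j, (1 - q j ^ 2) ^ (1 / (k : ℝ)) ≤ 1 - t ^ 2 := by
    rw [ht2]; linarith
  have ht1 : t < 1 := by nlinarith
  have hlog := Real.log_le_log hBp hle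
  rw [Real.log_prod fun j _ => (hBpos j).ne'] at hlog
  have hlogj : ∀ j, Real.log ((1 - q j ^ 2) ^ (1 / (k : ℝ))) =
      1 / (k : ℝ) * Real.log (1 - q j ^ 2) := fun j => Real.log_rpow (by linarith [hq j]) _
  simp only [hlogj] at hlog
  rw [← Finset.mul_sum] at hlog
  have h := hM t ⟨ht0, ht1⟩
  rw [htk] at h
  rw [Finset.sum_neg_distrib]
  have hlog' := mul_le_mul_of_nonneg_left hlog hk'.le
  rw [← mul_assoc, mul_one_div_cancel hk'.ne', one_mul] at hlog'
  linarith

/-- Pointwise bound splitting small overlaps from large ones. -/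
lemma exp_mul_prod_le {k : ℕ} (hk : 3 ≤ k) {M θ θ' r t : ℝ}
    (hM0 : 0 ≤ M) (hM : ∀ t ∈ Set.Ioo (0 : ℝ) 1, M * t ^ k ≤ -((k : ℝ) / 2) * Real.log (1 - t ^ 2))
    (hθ0 : 0 ≤ θ) (hθ : θ ≤ θ') (hr : 0 ≤ r) (ht0 : 0 ≤ t) (ht1 : t ≤ 1)
    (q : Fin k → ℝ) (hq : ∀ j, q j ^ 2 < 1) :
    Real.exp (r * (θ * M) * ∏ j, q j) ≤ Real.exp (θ * M * (r * t ^ 3)) +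
      Real.exp (-((θ' - θ) / 2 * (r * t ^ 2))) * ∏ j, (1 - q j ^ 2)⁻¹ ^ (θ' * r / 2) := by
  have hc : 0 ≤ r * (θ * M) := by positivity
  have hprod : ∏ j, q j ≤ ∏ j, |q j| := by
    rw [← Finset.abs_prod]; exact le_abs_self _
  have hlogj : ∀ j, q j ^ 2 ≤ -Real.log (1 - q j ^ 2) := fun j => by
    linarith [Real.log_le_sub_one_of_pos (show 0 < 1 - q j ^ 2 by linarith [hq j])]
  by_cases hsmall : ∀ j, |q j| ≤ t
  · have h1 : ∏ j, |q j| ≤ t ^ 3 := calc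
      ∏ j, |q j| ≤ ∏ _j : Fin k, t :=
        Finset.prod_le_prod (fun j _ => abs_nonneg _) fun j _ => hsmall j
      _ = t ^ k := by simp
      _ ≤ t ^ 3 := pow_le_pow_of_le_one ht0 ht1 hk
    have h2 : r * (θ * M) * ∏ j, q j ≤ θ * M * (r * t ^ 3) := calc
      _ ≤ r * (θ * M) * t ^ 3 := mul_le_mul_of_nonneg_left (hprod.trans h1) hc
      _ = _ := by ring
    refine (Real.exp_le_exp.2 h2).trans (le_add_of_nonneg_right ?_)
    refine mul_nonneg (Real.exp_pos _).le (Finset.prod_nonneg fun j _ => Real.rpow_nonneg ?_ _)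
    exact inv_nonneg.2 (by linarith [hq j])
  · push Not at hsmall
    obtain ⟨j, hj⟩ := hsmall
    set S := ∑ j, -Real.log (1 - q j ^ 2) with hS
    have hSt : t ^ 2 ≤ S := calc
      t ^ 2 ≤ q j ^ 2 := by rw [← sq_abs (q j)]; gcongr
      _ ≤ -Real.log (1 - q j ^ 2) := hlogj j
      _ ≤ S := Finset.single_le_sum (f := fun j => -Real.log (1 - q j ^ 2))
        (fun i _ => (sq_nonneg _).trans (hlogj i)) (Finset.mem_univ j)
    have hp : ∏ j, (1 - q j ^ 2)⁻¹ ^ (θ' * r / 2) = Real.exp (θ' * r / 2 * S) := by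
      rw [hS, Finset.mul_sum, Real.exp_sum]
      refine Finset.prod_congr rfl fun j _ => ?_
      rw [Real.rpow_def_of_pos (inv_pos.2 (by linarith [hq j])), Real.log_inv, mul_comm]
    rw [hp, ← Real.exp_add]
    refine le_trans (Real.exp_le_exp.2 ?_) (le_add_of_nonneg_left (Real.exp_pos _).le)
    have h1 := mul_prod_abs_le_sum_log (by lia) hM q hq
    calc r * (θ * M) * ∏ j, q j ≤ r * (θ * M) * ∏ j, |q j| :=
          mul_le_mul_of_nonneg_left hprod hc
      _ = r * θ * (M * ∏ j, |q j|) := by ring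
      _ ≤ r * θ * (1 / 2 * S) := mul_le_mul_of_nonneg_left h1 (by positivity)
      _ = -((θ' - θ) / 2 * (r * S)) + θ' * r / 2 * S := by ring
      _ ≤ _ := by
        have : 0 ≤ (θ' - θ) / 2 := by linarith
        gcongr

end Threshold

section Convergence

/-- The spike `√n λ v₁ ⊗ ⋯ ⊗ v_k`, after rescaling the noise to unit variance. -/
def scaledSpike (k n : ℕ) (lam : ℝ) (v : Fin k → EuclideanSpace ℝ (Fin n))
    (idx : Fin k → Fin n) : ℝ :=
  Real.sqrt n * (lam * ∏ j, v j (idx j))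

lemma measurable_scaledSpike (k n : ℕ) (lam : ℝ) : Measurable (scaledSpike k n lam) := by
  unfold scaledSpike
  fun_prop

lemma sum_scaledSpike_mul (k n : ℕ) (lam : ℝ) (v v' : Fin k → EuclideanSpace ℝ (Fin n)) :
    ∑ idx, scaledSpike k n lam v idx * scaledSpike k n lam v' idx =
      n * lam ^ 2 * ∏ j, ∑ i, v j i * v' j i := by
  rw [Finset.prod_univ_sum, Fintype.piFinset_univ, Finset.mul_sum]
  refine Finset.sum_congr rfl fun idx _ => ?_
  rw [Finset.prod_mul_distrib]
  simp only [scaledSpike]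
  calc _ = Real.sqrt n ^ 2 * lam ^ 2 * ((∏ j, v j (idx j)) * ∏ j, v' j (idx j)) := by ring
    _ = _ := by rw [Real.sq_sqrt n.cast_nonneg]

lemma tvDist_nonneg {Ω : Type*} [MeasurableSpace Ω] (P Q : Measure Ω) : 0 ≤ tvDist P Q :=
  Real.iSup_nonneg fun _ => abs_nonneg _

/-- The second moment method for the spiked asymmetric tensor. -/
lemma tvDist_spikedAsymTensor_le (k : ℕ) {n : ℕ} (hn : 0 < n) (lam : ℝ) {e : ℝ}
    (h : ∫⁻ v, ∫⁻ v', ENNReal.ofReal (Real.exp (n * lam ^ 2 * ∏ j, ∑ i, v j i * v' j i))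
        ∂(Measure.pi fun _ : Fin k => sphereUniform n)
        ∂(Measure.pi fun _ : Fin k => sphereUniform n) ≤ ENNReal.ofReal (1 + e)) :
    tvDist (spikedAsymTensor k n lam) (asymNoise k n) ≤ Real.sqrt e := by
  have hsn : Real.sqrt n ≠ 0 := (Real.sqrt_pos.2 (by exact_mod_cast hn)).ne'
  have hscale : Measurable fun (g : (Fin k → Fin n) → ℝ) idx => g idx / Real.sqrt n := by fun_prop
  have hsum : Measurable fun (p : (Fin k → EuclideanSpace ℝ (Fin n)) × ((Fin k → Fin n) → ℝ)) idx =>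
      lam * (∏ j, p.1 j (idx j)) + p.2 idx := by fun_prop
  have : IsProbabilityMeasure (asymNoise k n) :=
    Measure.isProbabilityMeasure_map hscale.aemeasurable
  have : Nonempty {s : Set ((Fin k → Fin n) → ℝ) // MeasurableSet s} := ⟨⟨∅, .empty⟩⟩
  refine ciSup_le fun ⟨A, hA⟩ => ?_
  have hnoise : asymNoise k n A =
      stdGaussianPi (Fin k → Fin n) ((fun g idx => g idx / Real.sqrt n) ⁻¹' A) :=
    Measure.map_apply hscale hA
  have hspiked : spikedAsymTensor k n lam A =
      ∫⁻ v, (stdGaussianPi (Fin k → Fin n)).map (fun x => x + scaledSpike k n lam v)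
        ((fun g idx => g idx / Real.sqrt n) ⁻¹' A)
        ∂(Measure.pi fun _ : Fin k => sphereUniform n) := by
    rw [spikedAsymTensor, Measure.map_apply hsum hA, Measure.prod_apply (hsum hA)]
    refine lintegral_congr fun v => ?_
    have hv : MeasurableSet (Prod.mk v ⁻¹' ((fun (p : (Fin k → EuclideanSpace ℝ (Fin n)) ×
        ((Fin k → Fin n) → ℝ)) idx => lam * (∏ j, p.1 j (idx j)) + p.2 idx) ⁻¹' A)) :=
      measurable_prodMk_left (hsum hA)
    rw [asymNoise, Measure.map_apply hscale hv,
      Measure.map_apply (by fun_prop) (hscale hA)]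
    congr 1
    ext x
    simp only [Set.mem_preimage, scaledSpike, Pi.add_apply, add_div, mul_div_cancel_left₀ _ hsn]
    simp only [add_comm]
  rw [hnoise, hspiked]
  refine abs_lintegral_map_add_sub_le _ (measurable_scaledSpike k n lam) ?_ (hscale hA)
  simpa only [sum_scaledSpike_mul] using h

lemma ae_sphereUniform_unit_or_zero (n : ℕ) :
    ∀ᵐ v ∂(sphereUniform n), ∑ i, v i ^ 2 = 1 ∨ ∀ i, v i = 0 := by
  have h0 : MeasurableSet {v : EuclideanSpace ℝ (Fin n) | ∀ i, v i = 0} := by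
    rw [Set.ofPred_forall]
    exact .iInter fun i => measurableSet_eq_fun
      (f := fun v : EuclideanSpace ℝ (Fin n) => v i) (by fun_prop) measurable_const
  have h1 : MeasurableSet {v : EuclideanSpace ℝ (Fin n) | ∑ i, v i ^ 2 = 1} :=
    measurableSet_eq_fun (by fun_prop) measurable_const
  rw [sphereUniform_eq_map_direction]
  exact (ae_map_iff measurable_direction.aemeasurable (h1.union h0)).2
    (Eventually.of_forall sum_direction_sq_eq_one_or_forall_eq_zero)

lemma ae_pi_forall {k : ℕ} {Ω : Type*} [MeasurableSpace Ω] (μ : Measure Ω) [IsProbabilityMeasure μ]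
    {p : Fin k → Ω → Prop} (hp : ∀ j, ∀ᵐ v ∂μ, p j v) :
    ∀ᵐ v ∂(Measure.pi fun _ : Fin k => μ), ∀ j, p j (v j) :=
  ae_all_iff.2 fun j => (Measure.quasiMeasurePreserving_eval (fun _ : Fin k => μ) j).ae (hp j)

lemma lintegral_exp_overlap_le {k n : ℕ} (hk : 3 ≤ k) (hn : 1 < n) {M θ θ' s t : ℝ}
    (hM0 : 0 ≤ M) (hM : ∀ t ∈ Set.Ioo (0 : ℝ) 1, M * t ^ k ≤ -((k : ℝ) / 2) * Real.log (1 - t ^ 2))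
    (hθ0 : 0 ≤ θ) (hθ : θ < θ') (hs : s < 1) (hθs : θ' * n / 2 < s * ((n : ℝ) - 1) / 2)
    (ht0 : 0 ≤ t) (ht1 : t ≤ 1) :
    ∫⁻ v, ∫⁻ v', ENNReal.ofReal (Real.exp (n * (θ * M) * ∏ j, ∑ i, v j i * v' j i))
        ∂(Measure.pi fun _ : Fin k => sphereUniform n)
        ∂(Measure.pi fun _ : Fin k => sphereUniform n) ≤
      ENNReal.ofReal (Real.exp (θ * M * (n * t ^ 3)) +
        Real.exp (-((θ' - θ) / 2 * (n * t ^ 2))) *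
          (1 + θ' * n / 2 * (Real.sqrt (1 - s))⁻¹ / (s * ((n : ℝ) - 1) / 2 - θ' * n / 2)) ^ k) := by
  have hn1 : (1 : ℝ) < n := by exact_mod_cast hn
  have ha : 0 < θ' * n / 2 := by
    have : 0 < θ' := by linarith
    positivity
  have hs0 : 0 ≤ s := by
    by_contra hneg
    nlinarith
  set K := 1 + θ' * n / 2 * (Real.sqrt (1 - s))⁻¹ / (s * ((n : ℝ) - 1) / 2 - θ' * n / 2) with hK
  have hK0 : 0 ≤ K := add_nonneg zero_le_one (div_nonneg (by positivity) (by linarith))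
  have hinner : ∀ᵐ v ∂(Measure.pi fun _ : Fin k => sphereUniform n),
      ∫⁻ v', ENNReal.ofReal (Real.exp (n * (θ * M) * ∏ j, ∑ i, v j i * v' j i))
        ∂(Measure.pi fun _ : Fin k => sphereUniform n) ≤
      ENNReal.ofReal (Real.exp (θ * M * (n * t ^ 3)) +
        Real.exp (-((θ' - θ) / 2 * (n * t ^ 2))) * K ^ k) := by
    filter_upwards [ae_pi_forall (sphereUniform n) fun _ : Fin k => ae_sphereUniform_unit_or_zero n]
      with v hv
    have hpt : ∀ᵐ v' ∂(Measure.pi fun _ : Fin k => sphereUniform n),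
        ENNReal.ofReal (Real.exp (n * (θ * M) * ∏ j, ∑ i, v j i * v' j i)) ≤
        ENNReal.ofReal (Real.exp (θ * M * (n * t ^ 3))) +
          ENNReal.ofReal (Real.exp (-((θ' - θ) / 2 * (n * t ^ 2)))) *
          ∏ j, ENNReal.ofReal ((1 - (∑ i, v j i * v' j i) ^ 2)⁻¹ ^ (θ' * n / 2)) := by
      filter_upwards [ae_pi_forall (sphereUniform n) fun j : Fin k =>
        ae_sphereUniform_overlap_sq_lt_one hn (v j) (hv j)] with v' hv'
      have hnn : ∀ j, 0 ≤ (1 - (∑ i, v j i * v' j i) ^ 2)⁻¹ ^ (θ' * n / 2) := fun j =>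
        Real.rpow_nonneg (inv_nonneg.2 (by linarith [hv' j])) _
      rw [← ENNReal.ofReal_prod_of_nonneg fun j _ => hnn j,
        ← ENNReal.ofReal_mul (Real.exp_pos _).le,
        ← ENNReal.ofReal_add (Real.exp_pos _).le
          (mul_nonneg (Real.exp_pos _).le (Finset.prod_nonneg fun j _ => hnn j))]
      exact ENNReal.ofReal_le_ofReal
        (exp_mul_prod_le hk hM0 hM hθ0 hθ.le n.cast_nonneg ht0 ht1 _ hv')
    refine (lintegral_mono_ae hpt).trans ?_
    rw [lintegral_add_left measurable_const, lintegral_const, measure_univ, mul_one,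
      lintegral_const_mul _ (by fun_prop),
      lintegral_pi_prod _ (f := fun j (u : EuclideanSpace ℝ (Fin n)) =>
        ENNReal.ofReal ((1 - (∑ i, v j i * u i) ^ 2)⁻¹ ^ (θ' * n / 2))) (fun j => by fun_prop),
      ENNReal.ofReal_add (Real.exp_pos _).le (by positivity),
      ENNReal.ofReal_mul (Real.exp_pos _).le, ENNReal.ofReal_pow hK0]
    gcongr
    calc _ ≤ ∏ _j : Fin k, ENNReal.ofReal K := Finset.prod_le_prod' fun j _ =>
          lintegral_sphereUniform_overlap_le (by lia) (v j) (hv j) hs0 hs ha hθs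
      _ = _ := by simp
  refine (lintegral_mono_ae hinner).trans ?_
  rw [lintegral_const, measure_univ, mul_one]

end Convergence

/-- for `k ≥ 3` and `0 ≤ λ < λ̄_k`, the total variation distance between the law
of the spiked asymmetric tensor `λ v₁⊗⋯⊗v_k + Z` and the law of `Z` tends to `0`. -/
theorem spiked_asym_tensor_tv_to_zero
    (k : ℕ) (hk : 3 ≤ k) (lam : ℝ) (hlam0 : 0 ≤ lam) (hlam : lam < lambdaBar k) :
    Tendsto (fun n => tvDist (spikedAsymTensor k n lam) (asymNoise k n)) atTop (nhds 0) := by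
  have hL : 0 < lambdaBar k := hlam0.trans_lt hlam
  set M := lambdaBar k ^ 2 with hMdef
  have hM : 0 < M := pow_pos hL 2
  set θ := lam ^ 2 / M with hθdef
  have hθ0 : 0 ≤ θ := by positivity
  have hθ1 : θ < 1 := by
    rw [hθdef, div_lt_one hM]
    exact pow_lt_pow_left₀ hlam hlam0 two_ne_zero
  have hθM : θ * M = lam ^ 2 := div_mul_cancel₀ _ hM.ne'
  obtain ⟨s, hθs, hs1⟩ := exists_between hθ1
  obtain ⟨θ', hθθ', hθ's⟩ := exists_between hθs
  have hgap : 0 < s - θ' := by linarith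
  have hθ'0 : 0 < θ' := by linarith
  set K := 1 + 2 * θ' * (Real.sqrt (1 - s))⁻¹ / (s - θ') with hK
  set e : ℕ → ℝ := fun n =>
    Real.exp (θ * M * (n : ℝ) ^ (-(1 / 5) : ℝ)) +
      Real.exp (-((θ' - θ) / 2 * (n : ℝ) ^ (1 / 5 : ℝ))) * K ^ k - 1 with he
  have hlim : Tendsto e atTop (nhds 0) := by
    have h1 : Tendsto (fun n : ℕ => Real.exp (θ * M * (n : ℝ) ^ (-(1 / 5) : ℝ))) atTop
        (nhds 1) := by
      have := ((tendsto_rpow_neg_atTop (y := 1 / 5) (by norm_num)).comp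
        tendsto_natCast_atTop_atTop).const_mul (θ * M)
      rw [mul_zero] at this
      simpa [Function.comp_def] using (Real.continuous_exp.tendsto 0).comp this
    have h2 : Tendsto (fun n : ℕ => Real.exp (-((θ' - θ) / 2 * (n : ℝ) ^ (1 / 5 : ℝ)))) atTop
        (nhds 0) := by
      refine Real.tendsto_exp_neg_atTop_nhds_zero.comp ?_
      exact ((tendsto_rpow_atTop (y := 1 / 5) (by norm_num)).comp
        tendsto_natCast_atTop_atTop).const_mul_atTop (by linarith)
    simpa [he] using (h1.add (h2.mul_const (K ^ k))).sub_const 1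
  have hsqrt : Tendsto (fun n => Real.sqrt (e n)) atTop (nhds 0) := by
    simpa [Function.comp_def] using (Real.continuous_sqrt.tendsto 0).comp hlim
  refine squeeze_zero' (Eventually.of_forall fun n => tvDist_nonneg _ _) ?_ hsqrt
  filter_upwards [eventually_gt_atTop 1,
    tendsto_natCast_atTop_atTop.eventually_ge_atTop (2 * s / (s - θ'))] with n hn hnb
  have hn0 : (0 : ℝ) < n := by exact_mod_cast (by lia : 0 < n)
  have hn1 : (1 : ℝ) ≤ n := by exact_mod_cast hn.le
  rw [div_le_iff₀ hgap] at hnb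
  have hden : (s - θ') * n / 4 ≤ s * ((n : ℝ) - 1) / 2 - θ' * n / 2 := by linarith
  have hden0 : 0 < (s - θ') * n / 4 := by positivity
  have ht1 : (n : ℝ) ^ (-(2 / 5) : ℝ) ≤ 1 := Real.rpow_le_one_of_one_le_of_nonpos hn1 (by norm_num)
  refine tvDist_spikedAsymTensor_le k (by lia) lam ?_
  rw [← hθM]
  refine (lintegral_exp_overlap_le hk hn hM.le (fun t ht => lambdaBar_sq_mul_pow_le hL ht) hθ0 hθθ'
    hs1 (by linarith) (Real.rpow_nonneg hn0.le _) ht1).trans (ENNReal.ofReal_le_ofReal ?_)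
  have h3 : (n : ℝ) * ((n : ℝ) ^ (-(2 / 5) : ℝ)) ^ 3 = (n : ℝ) ^ (-(1 / 5) : ℝ) := by
    rw [← Real.rpow_natCast, ← Real.rpow_mul hn0.le, ← Real.rpow_one_add' hn0.le (by norm_num)]
    norm_num
  have h2 : (n : ℝ) * ((n : ℝ) ^ (-(2 / 5) : ℝ)) ^ 2 = (n : ℝ) ^ (1 / 5 : ℝ) := by
    rw [← Real.rpow_natCast, ← Real.rpow_mul hn0.le, ← Real.rpow_one_add' hn0.le (by norm_num)]
    norm_num
  have hKle : 1 + θ' * n / 2 * (Real.sqrt (1 - s))⁻¹ / (s * ((n : ℝ) - 1) / 2 - θ' * n / 2) ≤ K := by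
    rw [hK]
    gcongr 1 + ?_
    calc θ' * n / 2 * (Real.sqrt (1 - s))⁻¹ / (s * ((n : ℝ) - 1) / 2 - θ' * n / 2)
        ≤ θ' * n / 2 * (Real.sqrt (1 - s))⁻¹ / ((s - θ') * n / 4) := by gcongr
      _ = _ := by field_simp; ring
  have hK0 : 0 ≤ 1 + θ' * n / 2 * (Real.sqrt (1 - s))⁻¹ /
      (s * ((n : ℝ) - 1) / 2 - θ' * n / 2) :=
    add_nonneg zero_le_one (div_nonneg (by positivity) (by linarith))
  rw [h3, h2, he]
  have := mul_le_mul_of_nonneg_left (pow_le_pow_left₀ hK0 hKle k)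
    (Real.exp_pos (-((θ' - θ) / 2 * (n : ℝ) ^ (1 / 5 : ℝ)))).le
  linarith

end
end

section
/- Fix k ≥ 3 and 0 ≤ β < β̄_k, where β̄_k = inf_{q∈(0,1)} √( −(1/q^k) log(1−q²) ). Let P_0 be the law of a symmetric standard normal tensor Z ∈ ⊗^k ℝ^n and P_β the law of X = β v^{⊗k} + Z with v uniform on S^{n−1} independent of Z. Then for any sequence of measurable tests T_n : ⊗^k ℝ^n → {0,1}, lim_{n→∞} [ P_0(T_n(X) = 1) + P_β(T_n(X) = 0) ] = 1; that is, below the threshold every test is asymptotically no better than random guessing. -/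
open MeasureTheory ProbabilityTheory Filter
open scoped ENNReal

noncomputable section

/-- Symmetric standard normal noise tensor: `Z = (1/k!)·√(2/n)·Σ_{π∈S_k} G^π`, where `G` has
i.i.d. `N(0,1)` entries and `(G^π)_{i₁…i_k} = G_{i_{π(1)},…,i_{π(k)}}`. -/
def symNoise (k n : ℕ) : Measure ((Fin k → Fin n) → ℝ) :=
  (stdGaussianPi (Fin k → Fin n)).map
    fun g idx => (1 / (Nat.factorial k : ℝ)) * Real.sqrt (2 / n) *
      ∑ π : Equiv.Perm (Fin k), g (idx ∘ π)

/-- Law of the spiked symmetric tensor `X = β v^{⊗k} + Z`, with `v` uniform on the unit sphere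
and `Z` an independent symmetric standard normal tensor. -/
def spikedSymTensor (k n : ℕ) (β : ℝ) : Measure ((Fin k → Fin n) → ℝ) :=
  ((sphereUniform n).prod (symNoise k n)).map
    fun p idx => β * (∏ j, p.1 (idx j)) + p.2 idx

/-- The second-moment threshold `β̄_k = inf_{q∈(0,1)} √(−(1/q^k) log(1−q²))`. -/
def betaBar (k : ℕ) : ℝ :=
  sInf {x : ℝ | ∃ q ∈ Set.Ioo (0 : ℝ) 1, x = Real.sqrt (-(1 / q ^ k) * Real.log (1 - q ^ 2))}

instance (ι : Type*) [Fintype ι] : IsProbabilityMeasure (stdGaussianPi ι) := by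
  unfold stdGaussianPi; infer_instance

lemma lintegral_pi_prod_eq_prod_lintegral {ι : Type*} [Fintype ι] {E : ι → Type*}
    [∀ i, MeasurableSpace (E i)] (μ : ∀ i, Measure (E i)) [∀ i, IsProbabilityMeasure (μ i)]
    (f : ∀ i, E i → ℝ≥0∞) (hf : ∀ i, Measurable (f i)) :
    ∫⁻ x, ∏ i, f i (x i) ∂Measure.pi μ = ∏ i, ∫⁻ y, f i y ∂μ i := by
  have hind : iIndepFun (fun i (x : ∀ i, E i) => f i (x i)) (Measure.pi μ) :=
    iIndepFun_pi (X := fun i => f i) fun i => (hf i).aemeasurable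
  rw [lintegral_prod_eq_prod_lintegral_of_indepFun Finset.univ _ hind
    fun i => (hf i).comp (measurable_pi_apply i)]
  exact Finset.prod_congr rfl fun i _ =>
    (measurePreserving_eval μ i).lintegral_comp (hf i)

lemma gaussianReal_eq_withDensity_exp (h : ℝ) :
    gaussianReal h 1 =
      (gaussianReal 0 1).withDensity fun x => ENNReal.ofReal (Real.exp (x * h - h ^ 2 / 2)) := by
  rw [gaussianReal_of_var_ne_zero h one_ne_zero, gaussianReal_of_var_ne_zero 0 one_ne_zero,
    ← withDensity_mul _ (measurable_gaussianPDF 0 1) (by fun_prop)]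
  congr 1
  ext x
  simp only [Pi.mul_apply, gaussianPDF]
  rw [← ENNReal.ofReal_mul (gaussianPDFReal_nonneg _ _ _), gaussianPDFReal, gaussianPDFReal,
    mul_assoc _ (Real.exp _), ← Real.exp_add]
  congr 3
  push_cast
  ring

/-- The density of the shift by `h` of a standard Gaussian vector. -/
def shiftDensity {ι : Type*} [Fintype ι] (h x : ι → ℝ) : ℝ :=
  Real.exp (∑ i, (x i * h i - h i ^ 2 / 2))

lemma shiftDensity_nonneg {ι : Type*} [Fintype ι] (h x : ι → ℝ) : 0 ≤ shiftDensity h x :=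
  (Real.exp_pos _).le

@[fun_prop]
lemma measurable_shiftDensity {ι α : Type*} [Fintype ι] [MeasurableSpace α] {f g : α → ι → ℝ}
    (hf : Measurable f) (hg : Measurable g) : Measurable fun a => shiftDensity (f a) (g a) := by
  unfold shiftDensity
  fun_prop

lemma stdGaussianPi_map_add {ι : Type*} [Fintype ι] (h : ι → ℝ) :
    (stdGaussianPi ι).map (fun x => x + h) =
      (stdGaussianPi ι).withDensity fun x => ENNReal.ofReal (shiftDensity h x) := by
  have hmap : (stdGaussianPi ι).map (fun x => x + h) =
      Measure.pi fun i => gaussianReal (h i) 1 := by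
    have := Measure.pi_map_pi (μ := fun _ : ι => gaussianReal 0 1)
      (f := fun i y => y + h i) fun i => (measurable_add_const (h i)).aemeasurable
    simp only [gaussianReal_map_add_const, zero_add] at this
    exact this
  rw [hmap]
  refine (Measure.pi_eq fun s hs => ?_)
  rw [withDensity_apply _ (MeasurableSet.univ_pi hs),
    ← lintegral_indicator (MeasurableSet.univ_pi hs)]
  have key : ∀ x, (Set.univ.pi s).indicator
      (fun x => ENNReal.ofReal (shiftDensity h x)) x =
      ∏ i, (s i).indicator (fun y => ENNReal.ofReal (Real.exp (y * h i - h i ^ 2 / 2))) (x i) := by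
    intro x
    by_cases hx : x ∈ Set.univ.pi s
    · rw [Set.indicator_of_mem hx, shiftDensity, Real.exp_sum,
        ENNReal.ofReal_prod_of_nonneg fun i _ => (Real.exp_pos _).le]
      exact Finset.prod_congr rfl fun i _ => by rw [Set.indicator_of_mem (hx i (Set.mem_univ i))]
    · rw [Set.indicator_of_notMem hx]
      simp only [Set.mem_univ_pi, not_forall] at hx
      obtain ⟨i, hi⟩ := hx
      exact (Finset.prod_eq_zero (Finset.mem_univ i) (Set.indicator_of_notMem hi _)).symm
  simp_rw [key]
  rw [stdGaussianPi, lintegral_pi_prod_eq_prod_lintegral _ _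
    fun i => Measurable.indicator (by fun_prop) (hs i)]
  refine Finset.prod_congr rfl fun i _ => ?_
  rw [lintegral_indicator (hs i), gaussianReal_eq_withDensity_exp (h i), withDensity_apply _ (hs i)]

lemma lintegral_shiftDensity {ι : Type*} [Fintype ι] (h : ι → ℝ) :
    ∫⁻ x, ENNReal.ofReal (shiftDensity h x) ∂stdGaussianPi ι = 1 := by
  have := congrArg (fun μ => μ Set.univ) (stdGaussianPi_map_add h)
  simp only [withDensity_apply _ MeasurableSet.univ, Measure.restrict_univ] at this
  rw [← this, Measure.map_apply (by fun_prop) MeasurableSet.univ]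
  simp

lemma lintegral_shiftDensity_mul {ι : Type*} [Fintype ι] (h h' : ι → ℝ) :
    ∫⁻ x, ENNReal.ofReal (shiftDensity h x) * ENNReal.ofReal (shiftDensity h' x) ∂stdGaussianPi ι
      = ENNReal.ofReal (Real.exp (∑ i, h i * h' i)) := by
  have key : ∀ x, ENNReal.ofReal (shiftDensity h x) * ENNReal.ofReal (shiftDensity h' x) =
      ENNReal.ofReal (Real.exp (∑ i, h i * h' i)) * ENNReal.ofReal (shiftDensity (h + h') x) := by
    intro x
    rw [← ENNReal.ofReal_mul (shiftDensity_nonneg _ _), ← ENNReal.ofReal_mul (Real.exp_pos _).le]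
    simp only [shiftDensity, ← Real.exp_add, ← Finset.sum_add_distrib]
    congr 2
    refine Finset.sum_congr rfl fun i _ => ?_
    simp only [Pi.add_apply]
    ring
  simp_rw [key]
  rw [lintegral_const_mul _ (by fun_prop), lintegral_shiftDensity, mul_one]

lemma lintegral_exp_mul_sq_gaussianReal {c : ℝ} (hc : c < 1 / 2) :
    ∫⁻ x, ENNReal.ofReal (Real.exp (c * x ^ 2)) ∂gaussianReal 0 1 =
      ENNReal.ofReal ((1 - 2 * c) ^ (-(1 / 2) : ℝ)) := by
  rw [gaussianReal_of_var_ne_zero 0 one_ne_zero,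
    lintegral_withDensity_eq_lintegral_mul _ (measurable_gaussianPDF 0 1) (by fun_prop)]
  have key : ∀ x : ℝ, (gaussianPDF 0 1 * fun x => ENNReal.ofReal (Real.exp (c * x ^ 2))) x =
      ENNReal.ofReal ((√(2 * Real.pi))⁻¹ * Real.exp (-(1 / 2 - c) * x ^ 2)) := by
    intro x
    simp only [Pi.mul_apply, gaussianPDF]
    rw [← ENNReal.ofReal_mul (gaussianPDFReal_nonneg _ _ _), gaussianPDFReal, mul_assoc,
      ← Real.exp_add]
    congr 3
    · simp
    · push_cast; ring
  simp_rw [key]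
  rw [← ofReal_integral_eq_lintegral_ofReal
    ((integrable_exp_neg_mul_sq (by linarith)).const_mul _)
    (ae_of_all _ fun x => by positivity), integral_const_mul, integral_gaussian]
  congr 1
  rw [Real.rpow_neg (by linarith), ← Real.sqrt_eq_rpow, ← Real.sqrt_inv, ← Real.sqrt_inv,
    ← Real.sqrt_mul (by positivity)]
  congr 1
  have : 1 - 2 * c ≠ 0 := by linarith
  have : 1 / 2 - c ≠ 0 := by linarith
  field_simp

lemma sq_withDensity_sub_le_of_lintegral_sq_le {Ω : Type*} [MeasurableSpace Ω] (μ : Measure Ω)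
    [IsProbabilityMeasure μ] {L : Ω → ℝ≥0∞} (hL : Measurable L) (hL1 : ∫⁻ x, L x ∂μ = 1)
    {ε : ℝ} (hε : 0 ≤ ε) (hL2 : ∫⁻ x, L x * L x ∂μ ≤ ENNReal.ofReal (1 + ε))
    {B : Set Ω} (hB : MeasurableSet B) :
    ((μ.withDensity L).real B - μ.real B) ^ 2 ≤ ε := by
  have hfin : ∀ᵐ x ∂μ, L x < ∞ := ae_lt_top hL (by simp [hL1])
  have hL_int : Integrable (fun x => (L x).toReal) μ :=
    integrable_toReal_of_lintegral_ne_top hL.aemeasurable (by simp [hL1])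
  have hmean : ∫ x, (L x).toReal ∂μ = 1 := by
    rw [integral_toReal hL.aemeasurable hfin, hL1, ENNReal.toReal_one]
  have hL2' : ∫⁻ x, L x * L x ∂μ ≠ ∞ := ne_top_of_le_ne_top ENNReal.ofReal_ne_top hL2
  have hL_sq_int : Integrable (fun x => (L x).toReal ^ 2) μ := by
    have := integrable_toReal_of_lintegral_ne_top (μ := μ) (f := fun x => L x * L x)
      (by fun_prop) hL2'
    simpa [ENNReal.toReal_mul, ← pow_two] using this
  have hmean2 : ∫ x, (L x).toReal ^ 2 ∂μ ≤ 1 + ε := by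
    have := integral_toReal (μ := μ) (f := fun x => L x * L x) (by fun_prop)
      (hfin.mono fun x hx => ENNReal.mul_lt_top hx hx)
    simp only [ENNReal.toReal_mul] at this
    simp only [pow_two]
    rw [this]
    refine ENNReal.toReal_le_of_le_ofReal (by linarith) ?_
    exact hL2
  have hmem : MemLp (fun x => (L x).toReal - 1) 2 μ :=
    ((memLp_two_iff_integrable_sq hL.ennreal_toReal.aestronglyMeasurable).2 hL_sq_int).sub
      (memLp_const 1)
  have hY := hmem.indicator hB
  have hYint : ∫ x, B.indicator (fun x => (L x).toReal - 1) x ∂μ =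
      (μ.withDensity L).real B - μ.real B := by
    rw [integral_indicator hB, integral_sub hL_int.integrableOn (integrable_const _).integrableOn,
      integral_toReal hL.aemeasurable.restrict (ae_restrict_of_ae hfin), Measure.real,
      withDensity_apply _ hB]
    simp
  have hYsq : ∫ x, (B.indicator (fun x => (L x).toReal - 1) ^ 2) x ∂μ ≤ ε := by
    calc ∫ x, (B.indicator (fun x => (L x).toReal - 1) ^ 2) x ∂μ
        ≤ ∫ x, ((L x).toReal - 1) ^ 2 ∂μ := by
          refine integral_mono hY.integrable_sq hmem.integrable_sq fun x => ?_
          by_cases hx : x ∈ B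
          · simp [hx]
          · simp [hx, sq_nonneg]
      _ = ∫ x, ((L x).toReal ^ 2 - 2 * (L x).toReal + 1) ∂μ := by
          congr 1 with x; ring
      _ ≤ ε := by
          have hsub : Integrable (fun x => (L x).toReal ^ 2 - 2 * (L x).toReal) μ :=
            hL_sq_int.sub (hL_int.const_mul 2)
          rw [integral_add hsub (integrable_const _),
            integral_sub hL_sq_int (hL_int.const_mul 2), integral_const_mul, hmean]
          simp
          linarith
  have hvar := variance_nonneg (B.indicator fun x => (L x).toReal - 1) μ
  rw [variance_eq_sub hY, hYint] at hvar
  linarith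

lemma map_prod_stdGaussianPi_add {ι V : Type*} [Fintype ι] [MeasurableSpace V] (ν : Measure V)
    [IsProbabilityMeasure ν] {h : V → ι → ℝ} (hh : Measurable h) :
    (ν.prod (stdGaussianPi ι)).map (fun p => p.2 + h p.1) =
      (stdGaussianPi ι).withDensity
        fun x => ∫⁻ v, ENNReal.ofReal (shiftDensity (h v) x) ∂ν := by
  ext B hB
  have hm : Measurable fun p : V × (ι → ℝ) => p.2 + h p.1 := by fun_prop
  rw [Measure.map_apply hm hB, Measure.prod_apply (hm hB), withDensity_apply _ hB,
    lintegral_lintegral_swap (Measurable.aemeasurable (by fun_prop))]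
  refine lintegral_congr fun v => ?_
  rw [← withDensity_apply _ hB, ← stdGaussianPi_map_add, Measure.map_apply (by fun_prop) hB]
  rfl

lemma sq_map_add_sub_stdGaussianPi_le {ι V : Type*} [Fintype ι] [MeasurableSpace V]
    (ν : Measure V) [IsProbabilityMeasure ν] {h : V → ι → ℝ} (hh : Measurable h)
    {ε : ℝ} (hε : 0 ≤ ε)
    (hle : ∫⁻ v, ∫⁻ w, ENNReal.ofReal (Real.exp (∑ i, h v i * h w i)) ∂ν ∂ν ≤
      ENNReal.ofReal (1 + ε)) {B : Set (ι → ℝ)} (hB : MeasurableSet B) :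
    (((ν.prod (stdGaussianPi ι)).map fun p => p.2 + h p.1).real B - (stdGaussianPi ι).real B) ^ 2
      ≤ ε := by
  rw [map_prod_stdGaussianPi_add ν hh]
  have hm : Measurable fun p : (ι → ℝ) × V => ENNReal.ofReal (shiftDensity (h p.2) p.1) := by
    fun_prop
  refine sq_withDensity_sub_le_of_lintegral_sq_le _ hm.lintegral_prod_right' ?_ hε ?_ hB
  · rw [lintegral_lintegral_swap hm.aemeasurable]
    simp [lintegral_shiftDensity]
  · refine le_trans (le_of_eq ?_) hle
    have hexpand : ∀ x, (∫⁻ v, ENNReal.ofReal (shiftDensity (h v) x) ∂ν) *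
        (∫⁻ w, ENNReal.ofReal (shiftDensity (h w) x) ∂ν) =
        ∫⁻ v, ∫⁻ w, ENNReal.ofReal (shiftDensity (h v) x) *
          ENNReal.ofReal (shiftDensity (h w) x) ∂ν ∂ν := by
      intro x
      rw [← lintegral_mul_const _ (by fun_prop)]
      refine lintegral_congr fun v => ?_
      rw [lintegral_const_mul _ (by fun_prop)]
    simp_rw [hexpand]
    rw [lintegral_lintegral_swap]
    · refine lintegral_congr fun v => ?_
      rw [lintegral_lintegral_swap (Measurable.aemeasurable (by fun_prop))]
      exact lintegral_congr fun w => lintegral_shiftDensity_mul _ _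
    · refine Measurable.aemeasurable ?_
      exact Measurable.lintegral_prod_right' (f := fun p : ((ι → ℝ) × V) × V =>
        ENNReal.ofReal (shiftDensity (h p.1.2) p.1.1) *
          ENNReal.ofReal (shiftDensity (h p.2) p.1.1)) (by fun_prop)

lemma stdGaussianPi_sq_coord_ge_le {n : ℕ} (i₀ : Fin n) {t δ : ℝ} (ht : t ∈ Set.Ioo (0 : ℝ) 1)
    (hδ : δ ∈ Set.Ioo (0 : ℝ) 1) :
    stdGaussianPi (Fin n) {x | t ^ 2 * ∑ i, x i ^ 2 ≤ x i₀ ^ 2} ≤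
      ENNReal.ofReal (δ ^ (-(1 / 2) : ℝ) * (1 - t ^ 2) ^ ((1 - δ) * (n - 1) / 2)) := by
  obtain ⟨ht0, ht1⟩ := ht
  obtain ⟨hδ0, hδ1⟩ := hδ
  have ht2 : 0 < 1 - t ^ 2 := by nlinarith
  have ht2' : 0 < t ^ 2 := by positivity
  set s : ℝ := (1 - δ) / (2 * (1 - t ^ 2)) with hs
  have hs0 : 0 < s := div_pos (by linarith) (by linarith)
  have hs1 : 2 * (s * (1 - t ^ 2)) = 1 - δ := by rw [hs]; field_simp
  set c : Fin n → ℝ := fun i => if i = i₀ then s * (1 - t ^ 2) else -(s * t ^ 2) with hc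
  have hci₀ : c i₀ = s * (1 - t ^ 2) := by simp [hc]
  have hcne : ∀ i, i ≠ i₀ → c i = -(s * t ^ 2) := fun i hi => by simp [hc, hi]
  have hclt : ∀ i, c i < 1 / 2 := by
    intro i
    by_cases hi : i = i₀
    · rw [hi, hci₀]; linarith
    · rw [hcne i hi]; nlinarith
  have hsum : ∀ x : Fin n → ℝ, ∑ i, c i * x i ^ 2 = s * (x i₀ ^ 2 - t ^ 2 * ∑ i, x i ^ 2) := by
    intro x
    rw [← Finset.add_sum_erase _ _ (Finset.mem_univ i₀), hci₀,
      ← Finset.add_sum_erase _ (fun i => x i ^ 2) (Finset.mem_univ i₀),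
      Finset.sum_congr rfl fun i hi => by rw [hcne i (Finset.ne_of_mem_erase hi)],
      ← Finset.mul_sum]
    ring
  have hfac : (1 - 2 * -(s * t ^ 2)) ^ (-(1 / 2) : ℝ) ≤ (1 - t ^ 2) ^ ((1 - δ) / 2) := by
    have hbern : (1 - t ^ 2) ^ δ ≤ 1 - δ * t ^ 2 := by
      have := rpow_one_add_le_one_add_mul_self (s := -t ^ 2) (p := δ) (by linarith) hδ0.le
        hδ1.le
      calc (1 - t ^ 2) ^ δ = (1 + -t ^ 2) ^ δ := by ring_nf
        _ ≤ 1 + δ * -t ^ 2 := this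
        _ = 1 - δ * t ^ 2 := by ring
    have hval : 1 - 2 * -(s * t ^ 2) = (1 - δ * t ^ 2) / (1 - t ^ 2) := by
      rw [hs]; field_simp; ring
    have hlow : (1 - t ^ 2) ^ (-(1 - δ)) ≤ 1 - 2 * -(s * t ^ 2) := by
      rw [hval, le_div_iff₀ ht2]
      calc (1 - t ^ 2) ^ (-(1 - δ)) * (1 - t ^ 2)
          = (1 - t ^ 2) ^ (-(1 - δ)) * (1 - t ^ 2) ^ (1 : ℝ) := by rw [Real.rpow_one]
        _ = (1 - t ^ 2) ^ δ := by rw [← Real.rpow_add ht2]; ring_nf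
        _ ≤ _ := hbern
    calc (1 - 2 * -(s * t ^ 2)) ^ (-(1 / 2) : ℝ)
        ≤ ((1 - t ^ 2) ^ (-(1 - δ))) ^ (-(1 / 2) : ℝ) :=
          Real.rpow_le_rpow_of_nonpos (Real.rpow_pos_of_pos ht2 _) hlow (by norm_num)
      _ = (1 - t ^ 2) ^ ((1 - δ) / 2) := by rw [← Real.rpow_mul ht2.le]; ring_nf
  calc stdGaussianPi (Fin n) {x | t ^ 2 * ∑ i, x i ^ 2 ≤ x i₀ ^ 2}
      ≤ ∫⁻ x, ∏ i, ENNReal.ofReal (Real.exp (c i * x i ^ 2)) ∂stdGaussianPi (Fin n) := by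
        refine meas_le_lintegral₀ (Measurable.aemeasurable (by fun_prop)) fun x hx => ?_
        rw [← ENNReal.ofReal_prod_of_nonneg fun i _ => (Real.exp_pos _).le, ← Real.exp_sum, hsum,
          ENNReal.one_le_ofReal, Real.one_le_exp_iff]
        exact mul_nonneg hs0.le (sub_nonneg.2 hx)
    _ = ∏ i, ENNReal.ofReal ((1 - 2 * c i) ^ (-(1 / 2) : ℝ)) := by
        rw [stdGaussianPi, lintegral_pi_prod_eq_prod_lintegral _
          (fun i y => ENNReal.ofReal (Real.exp (c i * y ^ 2))) fun i => by fun_prop]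
        exact Finset.prod_congr rfl fun i _ => lintegral_exp_mul_sq_gaussianReal (hclt i)
    _ ≤ _ := by
        have hpos : ∀ i, 0 ≤ (1 - 2 * c i) ^ (-(1 / 2) : ℝ) := fun i =>
          Real.rpow_nonneg (by linarith [hclt i]) _
        rw [← ENNReal.ofReal_prod_of_nonneg fun i _ => hpos i]
        refine ENNReal.ofReal_le_ofReal ?_
        rw [← Finset.mul_prod_erase _ _ (Finset.mem_univ i₀), hci₀, hs1]
        rw [show 1 - (1 - δ) = δ by ring]
        refine mul_le_mul_of_nonneg_left ?_ (Real.rpow_nonneg hδ0.le _)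
        calc ∏ i ∈ Finset.univ.erase i₀, (1 - 2 * c i) ^ (-(1 / 2) : ℝ)
            ≤ ∏ _i ∈ Finset.univ.erase i₀, (1 - t ^ 2) ^ ((1 - δ) / 2) := by
              refine Finset.prod_le_prod (fun i _ => hpos i) fun i hi => ?_
              rw [hcne i (Finset.ne_of_mem_erase hi)]
              exact hfac
          _ = (1 - t ^ 2) ^ ((1 - δ) * (n - 1) / 2) := by
              have hn : 1 ≤ n := Nat.one_le_of_lt i₀.2
              rw [Finset.prod_const, Finset.card_erase_of_mem (Finset.mem_univ i₀),
                Finset.card_univ, Fintype.card_fin, ← Real.rpow_natCast, ← Real.rpow_mul ht2.le,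
                Nat.cast_sub hn]
              congr 1
              push_cast
              ring

lemma stdGaussian_inner_ge_le {n : ℕ} {w : EuclideanSpace ℝ (Fin n)} (hw : ‖w‖ = 1) {t δ : ℝ}
    (ht : t ∈ Set.Ioo (0 : ℝ) 1) (hδ : δ ∈ Set.Ioo (0 : ℝ) 1) :
    stdGaussian (EuclideanSpace ℝ (Fin n)) {x | t * ‖x‖ ≤ |inner ℝ w x|} ≤
      ENNReal.ofReal (δ ^ (-(1 / 2) : ℝ) * (1 - t ^ 2) ^ ((1 - δ) * (n - 1) / 2)) := by
  have hn : 0 < n := by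
    rcases Nat.eq_zero_or_pos n with rfl | h
    · simp [Subsingleton.elim w 0] at hw
    · exact h
  set i₀ : Fin n := ⟨0, hn⟩
  obtain ⟨b, hb⟩ := Orthonormal.exists_orthonormalBasis_extension_of_card_eq (𝕜 := ℝ)
    (E := EuclideanSpace ℝ (Fin n)) (ι := Fin n) (by simp) (v := fun _ => w) (s := {i₀})
    (orthonormal_subsingleton_iff.2 fun _ => hw)
  have hb₀ : b i₀ = w := hb i₀ rfl
  rw [← stdGaussian_map b.repr.symm, ← map_pi_eq_stdGaussian,
    Measure.map_map (by fun_prop) (by fun_prop)]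
  rw [Measure.map_apply (by fun_prop) (measurableSet_le (by fun_prop) (by fun_prop))]
  refine le_trans (measure_mono fun x hx => ?_) (stdGaussianPi_sq_coord_ge_le i₀ ht hδ)
  simp only [Function.comp_apply, Set.mem_preimage, Set.mem_ofPred_eq,
    LinearIsometryEquiv.norm_map] at hx ⊢
  rw [← hb₀, ← b.repr_apply_apply, LinearIsometryEquiv.apply_symm_apply] at hx
  have hsq := pow_le_pow_left₀ (mul_nonneg ht.1.le (norm_nonneg _)) hx 2
  rw [mul_pow, EuclideanSpace.norm_sq_eq, sq_abs] at hsq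
  simpa using hsq

lemma sphereUniform_eq_map_stdGaussian (n : ℕ) :
    sphereUniform n = (stdGaussian (EuclideanSpace ℝ (Fin n))).map fun v => ‖v‖⁻¹ • v := by
  rw [← map_pi_eq_stdGaussian]
  rfl

instance inst_s18 (n : ℕ) : IsProbabilityMeasure (sphereUniform n) := by
  rw [sphereUniform_eq_map_stdGaussian]
  exact Measure.isProbabilityMeasure_map (by fun_prop)

lemma ae_norm_le_one_sphereUniform (n : ℕ) : ∀ᵐ v ∂sphereUniform n, ‖v‖ ≤ 1 := by
  rw [sphereUniform_eq_map_stdGaussian,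
    ae_map_iff (by fun_prop) (measurableSet_le (by fun_prop) (by fun_prop))]
  refine ae_of_all _ fun x => ?_
  rw [norm_smul, norm_inv, norm_norm]
  exact inv_mul_le_one

lemma sphereUniform_inner_ge_le {n : ℕ} {w : EuclideanSpace ℝ (Fin n)} (hw : ‖w‖ ≤ 1) {t δ : ℝ}
    (ht : t ∈ Set.Ioo (0 : ℝ) 1) (hδ : δ ∈ Set.Ioo (0 : ℝ) 1) :
    sphereUniform n {v | t ≤ |inner ℝ w v|} ≤
      ENNReal.ofReal (δ ^ (-(1 / 2) : ℝ) * (1 - t ^ 2) ^ ((1 - δ) * (n - 1) / 2)) := by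
  rcases eq_or_ne w 0 with rfl | hw0
  · simp [not_le.2 ht.1]
  have hwpos : 0 < ‖w‖ := norm_pos_iff.2 hw0
  rw [sphereUniform_eq_map_stdGaussian,
    Measure.map_apply (by fun_prop) (measurableSet_le (by fun_prop) (by fun_prop))]
  refine le_trans (measure_mono fun x hx => ?_)
    (stdGaussian_inner_ge_le (w := ‖w‖⁻¹ • w) ?_ ht hδ)
  · simp only [Set.mem_preimage, Set.mem_ofPred_eq, inner_smul_right, inner_smul_left, abs_mul,
      abs_inv, abs_norm, RCLike.conj_to_real] at hx ⊢
    have hx0 : 0 < ‖x‖ := by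
      by_contra h
      simp only [not_lt, norm_le_zero_iff] at h
      simp only [h, norm_zero, inv_zero, zero_mul] at hx
      exact absurd hx (not_le.2 ht.1)
    rw [inv_mul_eq_div, le_div_iff₀ hx0] at hx
    exact hx.trans (le_mul_of_one_le_left (abs_nonneg _) ((one_le_inv₀ hwpos).2 hw))
  · rw [norm_smul, norm_inv, norm_norm, inv_mul_cancel₀ hwpos.ne']

lemma lintegral_exp_inner_pow_le {n k : ℕ} (hk : k ≠ 0) {l δ : ℝ} (hl : 0 ≤ l)
    (hδ : δ ∈ Set.Ioo (0 : ℝ) 1) {w : EuclideanSpace ℝ (Fin n)} (hw : ‖w‖ ≤ 1) {H : ℝ → ℝ}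
    (hH0 : ∀ t, 0 ≤ H t) (hHint : IntegrableOn H (Set.Ioo 0 1))
    (hH : ∀ t ∈ Set.Ioo (0 : ℝ) 1,
      δ ^ (-(1 / 2) : ℝ) * (1 - t ^ 2) ^ ((1 - δ) * (n - 1) / 2) *
        (Real.exp (l * t ^ k) * (l * (k * t ^ (k - 1)))) ≤ H t) :
    ∫⁻ v, ENNReal.ofReal (Real.exp (l * |inner ℝ w v| ^ k)) ∂sphereUniform n ≤
      ENNReal.ofReal (1 + ∫ t in Set.Ioo (0 : ℝ) 1, H t) := by
  set g : ℝ → ℝ := fun t => Real.exp (l * t ^ k) * (l * (k * t ^ (k - 1))) with hg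
  have hgcont : Continuous g := by fun_prop
  have hg0 : ∀ t, 0 < t → 0 ≤ g t := fun t ht => by positivity
  have hprim : ∀ a : ℝ, ∫ t in (0 : ℝ)..a, g t = Real.exp (l * a ^ k) - 1 := by
    intro a
    rw [intervalIntegral.integral_eq_sub_of_hasDerivAt (f := fun t => Real.exp (l * t ^ k))
      (fun t _ => ((hasDerivAt_pow k t).const_mul l).exp) (hgcont.intervalIntegrable _ _)]
    simp [hk]
  have hprim0 : ∀ a : ℝ, 0 ≤ a → 0 ≤ ∫ t in (0 : ℝ)..a, g t := fun a ha => by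
    rw [hprim, sub_nonneg, Real.one_le_exp_iff]
    positivity
  have hcake := lintegral_comp_eq_lintegral_meas_le_mul (sphereUniform n)
    (f := fun v => |inner ℝ w v|) (g := g) (ae_of_all _ fun v => abs_nonneg _)
    (by fun_prop) (fun t _ => hgcont.intervalIntegrable _ _)
    ((ae_restrict_iff' measurableSet_Ioi).2 (ae_of_all _ hg0))
  have hne1 : ∀ᵐ t : ℝ, t ≠ 1 := compl_mem_ae_iff.2 (measure_singleton 1)
  calc ∫⁻ v, ENNReal.ofReal (Real.exp (l * |inner ℝ w v| ^ k)) ∂sphereUniform n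
      = ∫⁻ v, (1 + ENNReal.ofReal (∫ t in (0 : ℝ)..|inner ℝ w v|, g t)) ∂sphereUniform n := by
        refine lintegral_congr fun v => ?_
        rw [← ENNReal.ofReal_one, ← ENNReal.ofReal_add zero_le_one (hprim0 _ (abs_nonneg _)),
          hprim]
        congr 1
        ring
    _ = 1 + ∫⁻ t in Set.Ioi 0, sphereUniform n {v | t ≤ |inner ℝ w v|} * ENNReal.ofReal (g t) := by
        rw [lintegral_add_left measurable_const, hcake]
        simp
    _ ≤ 1 + ∫⁻ t in Set.Ioi 0, (Set.Ioo (0 : ℝ) 1).indicator (fun t => ENNReal.ofReal (H t)) t := by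
        gcongr 1 + ?_
        refine lintegral_mono_ae ?_
        filter_upwards [ae_restrict_mem measurableSet_Ioi, ae_restrict_of_ae hne1] with t ht0 ht1
        rcases lt_or_gt_of_ne ht1 with h | h
        · have htI : t ∈ Set.Ioo (0 : ℝ) 1 := ⟨ht0, h⟩
          rw [Set.indicator_of_mem htI]
          refine (mul_le_mul_left (sphereUniform_inner_ge_le hw htI hδ) _).trans ?_
          rw [← ENNReal.ofReal_mul' (hg0 t ht0)]
          exact ENNReal.ofReal_le_ofReal (hH t htI)
        · have hzero : sphereUniform n {v | t ≤ |inner ℝ w v|} = 0 := by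
            rw [measure_eq_zero_iff_ae_notMem]
            filter_upwards [ae_norm_le_one_sphereUniform n] with v hv hmem
            have := abs_real_inner_le_norm w v
            have : ‖w‖ * ‖v‖ ≤ 1 := mul_le_one₀ hw (norm_nonneg _) hv
            have : t ≤ |inner ℝ w v| := hmem
            linarith
          rw [hzero, zero_mul]
          exact zero_le
    _ = 1 + ∫⁻ t in Set.Ioo (0 : ℝ) 1, ENNReal.ofReal (H t) := by
        rw [lintegral_indicator measurableSet_Ioo, Measure.restrict_restrict measurableSet_Ioo,
          Set.inter_eq_left.2 Set.Ioo_subset_Ioi_self]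
    _ = ENNReal.ofReal (1 + ∫ t in Set.Ioo (0 : ℝ) 1, H t) := by
        rw [ENNReal.ofReal_add zero_le_one (integral_nonneg hH0), ENNReal.ofReal_one,
          ofReal_integral_eq_lintegral_ofReal hHint (ae_of_all _ hH0)]

lemma mul_exp_neg_mul_le {c : ℝ} (hc : 0 < c) (x : ℝ) : x * Real.exp (-(c * x)) ≤ 1 / c := by
  rw [Real.exp_neg, mul_inv_le_iff₀ (Real.exp_pos _), div_mul_eq_mul_div, one_mul,
    le_div_iff₀ hc]
  linarith [Real.add_one_le_exp (c * x)]

lemma tendsto_setIntegral_mul_exp_neg (C : ℝ) {c : ℝ} (hc : 0 < c) :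
    Tendsto (fun n : ℕ => ∫ t in Set.Ioo (0 : ℝ) 1,
      C * ((n * t ^ 2) * Real.exp (-(c * (n * t ^ 2))))) atTop (nhds 0) := by
  rw [show nhds (0 : ℝ) = nhds (∫ _t in Set.Ioo (0 : ℝ) 1, (0 : ℝ)) by simp]
  refine tendsto_integral_of_dominated_convergence (F := fun (n : ℕ) (t : ℝ) =>
      C * ((n * t ^ 2) * Real.exp (-(c * (n * t ^ 2))))) (fun _ => |C| * (1 / c))
    (fun n => (Continuous.aestronglyMeasurable (by fun_prop))) (integrable_const _)
    (fun n => ae_of_all _ fun t => ?_) ?_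
  · rw [norm_mul, Real.norm_eq_abs, Real.norm_of_nonneg (by positivity)]
    exact mul_le_mul_of_nonneg_left (mul_exp_neg_mul_le hc _) (abs_nonneg _)
  · filter_upwards [ae_restrict_mem measurableSet_Ioo] with t ht
    have hy : Tendsto (fun n : ℕ => c * (n * t ^ 2)) atTop atTop :=
      (tendsto_natCast_atTop_atTop.atTop_mul_const (pow_pos ht.1 2)).const_mul_atTop hc
    have := ((Real.tendsto_pow_mul_exp_neg_atTop_nhds_zero 1).comp hy).const_mul (C / c)
    rw [mul_zero] at this
    refine this.congr fun n => ?_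
    simp only [Function.comp_apply, pow_one]
    field_simp

lemma betaBar_sq_mul_pow_le {k : ℕ} (hb : 0 ≤ betaBar k) {q : ℝ} (hq : q ∈ Set.Ioo (0 : ℝ) 1) :
    betaBar k ^ 2 * q ^ k ≤ -Real.log (1 - q ^ 2) := by
  have hqk : 0 < q ^ k := pow_pos hq.1 k
  have hle : betaBar k ≤ Real.sqrt (-(1 / q ^ k) * Real.log (1 - q ^ 2)) :=
    csInf_le ⟨0, by rintro _ ⟨_, _, rfl⟩; exact Real.sqrt_nonneg _⟩ ⟨q, hq, rfl⟩
  have hlog : Real.log (1 - q ^ 2) ≤ 0 :=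
    Real.log_nonpos (by nlinarith [hq.1, hq.2]) (by nlinarith [hq.1])
  have hnonneg : 0 ≤ -(1 / q ^ k) * Real.log (1 - q ^ 2) :=
    mul_nonneg_of_nonpos_of_nonpos (neg_nonpos.2 (by positivity)) hlog
  have := (Real.le_sqrt hb hnonneg).1 hle
  calc betaBar k ^ 2 * q ^ k ≤ (-(1 / q ^ k) * Real.log (1 - q ^ 2)) * q ^ k :=
        mul_le_mul_of_nonneg_right this hqk.le
    _ = -Real.log (1 - q ^ 2) := by field_simp

/-- Below the threshold, the exponential moment of the overlap of a uniform point of the sphere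
with any vector of norm at most one tends to `1`. -/
lemma exists_tendsto_zero_lintegral_exp_inner_pow_le {k : ℕ} (hk : 3 ≤ k) {β : ℝ} (hβ0 : 0 ≤ β)
    (hβ : β < betaBar k) :
    ∃ ε : ℕ → ℝ, Tendsto ε atTop (nhds 0) ∧ (∀ n, 0 ≤ ε n) ∧ ∀ᶠ n : ℕ in atTop,
      ∀ w : EuclideanSpace ℝ (Fin n), ‖w‖ ≤ 1 →
        ∫⁻ v, ENNReal.ofReal (Real.exp (n * β ^ 2 / 2 * |inner ℝ w v| ^ k)) ∂sphereUniform n ≤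
          ENNReal.ofReal (1 + ε n) := by
  have hb : 0 < betaBar k := hβ0.trans_lt hβ
  set ρ : ℝ := β ^ 2 / betaBar k ^ 2 with hρ
  have hρ0 : 0 ≤ ρ := by positivity
  have hρ1 : ρ < 1 := by
    rw [hρ, div_lt_one (by positivity)]
    exact pow_lt_pow_left₀ hβ hβ0 two_ne_zero
  set δ : ℝ := (1 - ρ) / 2 with hδdef
  have hδ : δ ∈ Set.Ioo (0 : ℝ) 1 := ⟨by rw [hδdef]; linarith, by rw [hδdef]; linarith⟩
  set c : ℝ := (1 - ρ) / 8 with hcdef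
  have hc : 0 < c := by rw [hcdef]; linarith
  set C : ℝ := δ ^ (-(1 / 2) : ℝ) * (β ^ 2 / 2 * k) with hC
  have hδpow : 0 ≤ δ ^ (-(1 / 2) : ℝ) := Real.rpow_nonneg hδ.1.le _
  have hC0 : 0 ≤ C := by positivity
  refine ⟨fun n => ∫ t in Set.Ioo (0 : ℝ) 1, C * ((n * t ^ 2) * Real.exp (-(c * (n * t ^ 2)))),
    tendsto_setIntegral_mul_exp_neg C hc, fun n => integral_nonneg fun t => by positivity, ?_⟩
  filter_upwards [tendsto_natCast_atTop_atTop.eventually_ge_atTop (4 / (1 - ρ))] with n hn w hw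
  rw [div_le_iff₀ (by linarith)] at hn
  refine lintegral_exp_inner_pow_le (by omega) (by positivity) hδ hw (fun t => by positivity)
    ?_ fun t ht => ?_
  · exact (Continuous.integrableOn_Icc (by fun_prop)).mono_set Set.Ioo_subset_Icc_self
  have ht2 : 0 < 1 - t ^ 2 := by nlinarith [ht.1, ht.2]
  have hlog : t ^ 2 ≤ -Real.log (1 - t ^ 2) := by
    linarith [Real.log_le_sub_one_of_pos ht2]
  have hthr : β ^ 2 * t ^ k ≤ ρ * -Real.log (1 - t ^ 2) := by
    have := mul_le_mul_of_nonneg_left (betaBar_sq_mul_pow_le hb.le ht) hρ0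
    calc β ^ 2 * t ^ k = ρ * (betaBar k ^ 2 * t ^ k) := by rw [hρ]; field_simp
      _ ≤ _ := this
  have hexp : (1 - t ^ 2) ^ ((1 - δ) * (n - 1) / 2) * Real.exp (n * β ^ 2 / 2 * t ^ k) ≤
      Real.exp (-(c * (n * t ^ 2))) := by
    rw [Real.rpow_def_of_pos ht2, ← Real.exp_add, Real.exp_le_exp]
    set L : ℝ := -Real.log (1 - t ^ 2) with hL
    have hL0 : 0 ≤ L := (sq_nonneg t).trans hlog
    have hlogL : Real.log (1 - t ^ 2) = -L := by rw [hL, neg_neg]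
    have hn0 : (0 : ℝ) ≤ n := Nat.cast_nonneg n
    have h1 : n * β ^ 2 / 2 * t ^ k ≤ n / 2 * (ρ * L) := by
      have := mul_le_mul_of_nonneg_left hthr (by positivity : (0 : ℝ) ≤ n / 2)
      linarith
    have h2 : c * (n * t ^ 2) ≤ c * (n * L) := by gcongr
    have h3 : L * (n * ρ / 2 - (1 - δ) * (n - 1) / 2 + c * n) ≤ 0 := by
      refine mul_nonpos_of_nonneg_of_nonpos hL0 ?_
      rw [hδdef, hcdef]
      linarith
    rw [hlogL]
    linarith
  have hpow : t ^ (k - 1) ≤ t ^ 2 := pow_le_pow_of_le_one ht.1.le ht.2.le (by omega)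
  calc δ ^ (-(1 / 2) : ℝ) * (1 - t ^ 2) ^ ((1 - δ) * (n - 1) / 2) *
        (Real.exp (n * β ^ 2 / 2 * t ^ k) * (n * β ^ 2 / 2 * (k * t ^ (k - 1))))
      = C * (n * t ^ (k - 1) *
        ((1 - t ^ 2) ^ ((1 - δ) * (n - 1) / 2) * Real.exp (n * β ^ 2 / 2 * t ^ k))) := by
        rw [hC]; ring
    _ ≤ C * ((n * t ^ 2) * Real.exp (-(c * (n * t ^ 2)))) := by
        gcongr

lemma sum_prod_mul_prod_eq_inner_pow {k n : ℕ} (v w : EuclideanSpace ℝ (Fin n)) :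
    ∑ idx : Fin k → Fin n, (∏ j, v (idx j)) * ∏ j, w (idx j) = (inner ℝ v w) ^ k := by
  rw [PiLp.inner_apply, Fintype.sum_pow]
  refine Finset.sum_congr rfl fun idx _ => ?_
  rw [← Finset.prod_mul_distrib]
  exact Finset.prod_congr rfl fun j _ => by simp [mul_comm]

/-- The symmetrized and rescaled tensor whose law under the standard Gaussian is `symNoise`. -/
def symmetrize (k n : ℕ) (g : (Fin k → Fin n) → ℝ) (idx : Fin k → Fin n) : ℝ :=
  (1 / (Nat.factorial k : ℝ)) * Real.sqrt (2 / n) * ∑ π : Equiv.Perm (Fin k), g (idx ∘ π)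

@[fun_prop]
lemma measurable_symmetrize (k n : ℕ) : Measurable (symmetrize k n) := by
  unfold symmetrize
  fun_prop

lemma symNoise_eq_map_symmetrize (k n : ℕ) :
    symNoise k n = (stdGaussianPi (Fin k → Fin n)).map (symmetrize k n) := rfl

lemma symmetrize_add (k n : ℕ) (g h : (Fin k → Fin n) → ℝ) :
    symmetrize k n (g + h) = symmetrize k n g + symmetrize k n h := by
  ext idx
  simp only [symmetrize, Pi.add_apply, Finset.sum_add_distrib]
  ring

lemma symmetrize_rankOne (k : ℕ) {n : ℕ} (hn : n ≠ 0) (β : ℝ) (v : EuclideanSpace ℝ (Fin n)) :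
    symmetrize k n (fun idx => β * Real.sqrt (n / 2) * ∏ j, v (idx j)) =
      fun idx => β * ∏ j, v (idx j) := by
  ext idx
  have hperm : ∀ π : Equiv.Perm (Fin k), ∏ j, v ((idx ∘ π) j) = ∏ j, v (idx j) := fun π =>
    Equiv.prod_comp π fun j => v (idx j)
  have hn' : (n : ℝ) ≠ 0 := Nat.cast_ne_zero.2 hn
  have hsqrt : Real.sqrt (2 / n) * Real.sqrt (n / 2) = 1 := by
    rw [← Real.sqrt_mul (by positivity), div_mul_div_cancel₀ hn', div_self two_ne_zero,
      Real.sqrt_one]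
  simp only [symmetrize, hperm, Finset.sum_const, Finset.card_univ, Fintype.card_perm,
    Fintype.card_fin, nsmul_eq_mul]
  have hfac : (Nat.factorial k : ℝ) ≠ 0 := by exact_mod_cast Nat.factorial_ne_zero k
  calc _ = (Real.sqrt (2 / n) * Real.sqrt (n / 2)) * ((Nat.factorial k : ℝ) / Nat.factorial k) *
        (β * ∏ j, v (idx j)) := by ring
    _ = _ := by rw [hsqrt, div_self hfac]; ring

lemma spikedSymTensor_eq_map_symmetrize (k : ℕ) {n : ℕ} (hn : n ≠ 0) (β : ℝ) :
    spikedSymTensor k n β =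
      (((sphereUniform n).prod (stdGaussianPi (Fin k → Fin n))).map fun p =>
        p.2 + fun idx => β * Real.sqrt (n / 2) * ∏ j, p.1 (idx j)).map (symmetrize k n) := by
  rw [Measure.map_map (by fun_prop) (by fun_prop), spikedSymTensor, symNoise_eq_map_symmetrize]
  nth_rewrite 1 [← Measure.map_id (μ := sphereUniform n)]
  rw [Measure.map_prod_map _ _ measurable_id (by fun_prop),
    Measure.map_map (by fun_prop) (by fun_prop)]
  congr 1
  ext p idx
  simp only [Function.comp_apply, symmetrize_add, symmetrize_rankOne k hn, Prod.map, id,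
    Pi.add_apply]
  ring

lemma sum_rankOne_mul_rankOne_le {k n : ℕ} (β : ℝ) (v w : EuclideanSpace ℝ (Fin n)) :
    ∑ idx : Fin k → Fin n, (β * Real.sqrt (n / 2) * ∏ j, v (idx j)) *
        (β * Real.sqrt (n / 2) * ∏ j, w (idx j)) ≤ n * β ^ 2 / 2 * |inner ℝ v w| ^ k := by
  calc ∑ idx : Fin k → Fin n, (β * Real.sqrt (n / 2) * ∏ j, v (idx j)) *
        (β * Real.sqrt (n / 2) * ∏ j, w (idx j))
      = β ^ 2 * Real.sqrt (n / 2) ^ 2 *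
          ∑ idx : Fin k → Fin n, (∏ j, v (idx j)) * ∏ j, w (idx j) := by
        rw [Finset.mul_sum]
        exact Finset.sum_congr rfl fun idx _ => by ring
    _ = n * β ^ 2 / 2 * (inner ℝ v w) ^ k := by
        rw [sum_prod_mul_prod_eq_inner_pow, Real.sq_sqrt (by positivity)]
        ring
    _ ≤ n * β ^ 2 / 2 * |inner ℝ v w| ^ k := by
        rw [← abs_pow]
        exact mul_le_mul_of_nonneg_left (le_abs_self _) (by positivity)

lemma sq_map_add_rankOne_sub_stdGaussianPi_le {k n : ℕ} {β ε : ℝ} (hε : 0 ≤ ε)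
    (hle : ∀ w : EuclideanSpace ℝ (Fin n), ‖w‖ ≤ 1 →
      ∫⁻ v, ENNReal.ofReal (Real.exp (n * β ^ 2 / 2 * |inner ℝ w v| ^ k)) ∂sphereUniform n ≤
        ENNReal.ofReal (1 + ε))
    {B : Set ((Fin k → Fin n) → ℝ)} (hB : MeasurableSet B) :
    ((((sphereUniform n).prod (stdGaussianPi (Fin k → Fin n))).map fun p =>
        p.2 + fun idx => β * Real.sqrt (n / 2) * ∏ j, p.1 (idx j)).real B -
      (stdGaussianPi (Fin k → Fin n)).real B) ^ 2 ≤ ε := by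
  have hmeas : Measurable fun (v : EuclideanSpace ℝ (Fin n)) (idx : Fin k → Fin n) =>
      β * Real.sqrt (n / 2) * ∏ j, v (idx j) := by fun_prop
  refine sq_map_add_sub_stdGaussianPi_le (sphereUniform n) hmeas hε ?_ hB
  have hinner : ∀ᵐ v ∂sphereUniform n,
      ∫⁻ w, ENNReal.ofReal (Real.exp (∑ idx : Fin k → Fin n,
        (β * Real.sqrt (n / 2) * ∏ j, v (idx j)) * (β * Real.sqrt (n / 2) * ∏ j, w (idx j))))
          ∂sphereUniform n ≤ ENNReal.ofReal (1 + ε) := by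
    filter_upwards [ae_norm_le_one_sphereUniform n] with v hv
    exact (lintegral_mono fun w => ENNReal.ofReal_le_ofReal
      (Real.exp_le_exp.2 (sum_rankOne_mul_rankOne_le β v w))).trans (hle v hv)
  exact (lintegral_mono_ae hinner).trans (by simp)

/-- for `k ≥ 3` and `0 ≤ β < β̄_k`, every sequence of measurable tests is
asymptotically no better than random guessing:
`P_0(T_n(X) = 1) + P_β(T_n(X) = 0) → 1`. -/
theorem tests_no_better_than_random
    (k : ℕ) (hk : 3 ≤ k) (β : ℝ) (hβ0 : 0 ≤ β) (hβ : β < betaBar k)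
    (T : ∀ n, ((Fin k → Fin n) → ℝ) → Bool) (hT : ∀ n, Measurable (T n)) :
    Tendsto (fun n =>
        (symNoise k n {x | T n x = true}).toReal
          + (spikedSymTensor k n β {x | T n x = false}).toReal)
      atTop (nhds 1) := by
  obtain ⟨ε, hε, hε0, hbound⟩ := exists_tendsto_zero_lintegral_exp_inner_pow_le hk hβ0 hβ
  have hsqrt : Tendsto (fun n => Real.sqrt (ε n)) atTop (nhds 0) := by
    simpa using hε.sqrt
  rw [tendsto_iff_dist_tendsto_zero]
  refine squeeze_zero' (Eventually.of_forall fun _ => dist_nonneg) ?_ hsqrt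
  filter_upwards [hbound, eventually_ne_atTop 0] with n hn hn0
  have hB : MeasurableSet {x | T n x = false} := hT n (measurableSet_singleton false)
  have hB' : MeasurableSet (symmetrize k n ⁻¹' {x | T n x = false}) :=
    measurable_symmetrize k n hB
  have hcompl : {x | T n x = true} = {x | T n x = false}ᶜ := by
    ext x
    simp
  have : IsProbabilityMeasure (symNoise k n) :=
    Measure.isProbabilityMeasure_map (measurable_symmetrize k n).aemeasurable
  rw [Real.dist_eq, ← Measure.real, ← Measure.real, hcompl, probReal_compl_eq_one_sub hB,
    spikedSymTensor_eq_map_symmetrize k hn0, symNoise_eq_map_symmetrize,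
    map_measureReal_apply (by fun_prop) hB, map_measureReal_apply (by fun_prop) hB]
  rw [sub_add_comm, add_sub_cancel_right]
  exact Real.abs_le_sqrt (sq_map_add_rankOne_sub_stdGaussianPi_le (hε0 n) hn hB')

end
end
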